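/- arXiv:1308.2902 — 3 statements merged into one kernel-verified Lean document; each statement's English description precedes it below -/
import Mathlib

section
/- Let ρ be holomorphic near 0 in ℂ² with ρ₀₀ = ρ₁₀ = ρ₀₁ = ρ₂₀ = ρ₁₁ = 0 and ρ₀₂ ≠ 0, where ρᵢⱼ denotes the partial derivative ∂^{i+j}ρ/∂xⁱ∂yʲ at the origin. Then there exists a holomorphic coordinate chart (u,v) centered at the origin in which ρ equals either v², or v² + u^{k+1} for some k ≥ 2. -/
/-!
STATEMENT 2 (A_k normal form): If ρ is holomorphic near 0 in ℂ² with
ρ₀₀ = ρ₁₀ = ρ₀₁ = ρ₂₀ = ρ₁₁ = 0 and ρ₀₂ ≠ 0 (where ρᵢⱼ = ∂^{i+j}ρ/∂xⁱ∂yʲ at the origin),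
then there is a holomorphic coordinate chart (u,v) centered at the origin in which
ρ equals either v², or v² + u^{k+1} for some k ≥ 2.
-/

/-- `pd i j f` is the partial derivative `∂^{i+j} f / ∂x^i ∂y^j` at the origin of `ℂ²`. -/
noncomputable def pd (i j : ℕ) (f : ℂ × ℂ → ℂ) : ℂ :=
  iteratedDeriv i (fun x => iteratedDeriv j (fun y => f (x, y)) 0) 0

open Filter Topology
open scoped NNReal ENNReal

noncomputable def prX : ℂ × ℂ →L[ℂ] ℂ × ℂ :=
  (ContinuousLinearMap.inl ℂ ℂ ℂ).comp (ContinuousLinearMap.fst ℂ ℂ ℂ)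

lemma prX_apply (z : ℂ × ℂ) : prX z = (z.1, 0) := rfl

lemma norm_prX_le : ‖prX‖ ≤ 1 := by
  refine ContinuousLinearMap.opNorm_le_bound _ zero_le_one fun z => ?_
  rw [prX_apply, one_mul, Prod.norm_def, Prod.norm_def]
  simp

noncomputable def divSer (p : FormalMultilinearSeries ℂ (ℂ × ℂ) ℂ) :
    FormalMultilinearSeries ℂ (ℂ × ℂ) ℂ := fun n =>
  ∑ k : Fin (n + 1), ((p (n + 1)).curryMid k ((0, 1) : ℂ × ℂ)).compContinuousLinearMap
    (fun i => if k.succAbove i < k then ContinuousLinearMap.id ℂ (ℂ × ℂ) else prX)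

lemma norm_divSer_le (p : FormalMultilinearSeries ℂ (ℂ × ℂ) ℂ) (n : ℕ) :
    ‖divSer p n‖ ≤ (n + 1) * ‖p (n + 1)‖ := by
  unfold divSer
  refine (norm_sum_le _ _).trans ?_
  have : ∀ k ∈ (Finset.univ : Finset (Fin (n+1))), ‖((p (n + 1)).curryMid k ((0, 1) : ℂ × ℂ)).compContinuousLinearMap
    (fun i => if k.succAbove i < k then ContinuousLinearMap.id ℂ (ℂ × ℂ) else prX)‖ ≤ ‖p (n+1)‖ := by
    intro k _
    refine (ContinuousMultilinearMap.norm_compContinuousLinearMap_le _ _).trans ?_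
    have h1 : ‖(p (n + 1)).curryMid k ((0, 1) : ℂ × ℂ)‖ ≤ ‖p (n+1)‖ := by
      refine (ContinuousLinearMap.le_opNorm _ _).trans ?_
      rw [ContinuousMultilinearMap.norm_curryMid]
      simp [Prod.norm_def]
    have h2 : ∏ i : Fin n, ‖(if k.succAbove i < k then ContinuousLinearMap.id ℂ (ℂ × ℂ) else prX)‖ ≤ 1 := by
      refine Finset.prod_le_one (fun _ _ => norm_nonneg _) fun i _ => ?_
      split_ifs
      · exact ContinuousLinearMap.norm_id_le
      · exact norm_prX_le
    calc _ ≤ ‖p (n+1)‖ * 1 := mul_le_mul h1 h2 (Finset.prod_nonneg fun _ _ => norm_nonneg _) (norm_nonneg _)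
      _ = _ := mul_one _
  refine (Finset.sum_le_card_nsmul _ _ _ this).trans ?_
  simp

lemma radius_divSer (p : FormalMultilinearSeries ℂ (ℂ × ℂ) ℂ) (hp : 0 < p.radius) :
    0 < (divSer p).radius := by
  obtain ⟨r, hr0, hr⟩ := ENNReal.lt_iff_exists_nnreal_btwn.1 hp
  have hr0 : 0 < r := by exact_mod_cast hr0
  obtain ⟨C, hC, h⟩ := p.norm_mul_pow_le_of_lt_radius hr
  have := (divSer p).le_radius_of_bound (r := r / 2) (C / r) (fun n => by
    have h1 := norm_divSer_le p n
    have h2 := h (n + 1)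
    have hr' : (0 : ℝ) < r := hr0
    rw [le_div_iff₀ hr']
    have h3 : ((n : ℝ) + 1) ≤ 2 ^ n := by
      exact_mod_cast Nat.succ_le_of_lt (Nat.lt_two_pow_self (n := n))
    push_cast
    rw [div_pow]
    calc ‖divSer p n‖ * ((r:ℝ) ^ n / 2 ^ n) * r
        ≤ ((n + 1) * ‖p (n + 1)‖) * ((r:ℝ) ^ n / 2 ^ n) * r := by gcongr
      _ = ((n + 1) / 2 ^ n) * (‖p (n + 1)‖ * (r:ℝ) ^ (n + 1)) := by ring
      _ ≤ 1 * (‖p (n + 1)‖ * (r:ℝ) ^ (n + 1)) := by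
        gcongr
        rw [div_le_one (by positivity)]; exact h3
      _ ≤ C := by rw [one_mul]; exact h2)
  refine lt_of_lt_of_le ?_ this
  have : 0 < r / 2 := by positivity
  exact_mod_cast this

lemma divSer_apply (p : FormalMultilinearSeries ℂ (ℂ × ℂ) ℂ) (n : ℕ) (z : ℂ × ℂ) :
    z.2 * (divSer p n fun _ => z) = (p (n + 1) fun _ => z) - (p (n + 1) fun _ => prX z) := by
  have h := (p (n + 1)).toMultilinearMap.map_sub_map_piecewise (fun _ => z) (fun _ => prX z)
    Finset.univ
  simp only [Finset.piecewise_univ, Finset.mem_univ, forall_true_left] at h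
  refine Eq.trans ?_ h.symm
  unfold divSer
  rw [sum_apply, Finset.mul_sum]
  refine Finset.sum_congr rfl fun k _ => ?_
  rw [ContinuousMultilinearMap.compContinuousLinearMap_apply,
    ContinuousMultilinearMap.curryMid_apply, ← smul_eq_mul]
  set m : Fin n → ℂ × ℂ := fun i => (if k.succAbove i < k then ContinuousLinearMap.id ℂ (ℂ × ℂ) else prX) z with hm
  have e1 : k.insertNth (α := fun _ => ℂ × ℂ) ((0, 1) : ℂ × ℂ) m =
    Function.update (k.insertNth (α := fun _ => ℂ × ℂ) ((0, 1) : ℂ × ℂ) m) k (0, 1) := by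
    simp
  rw [e1, ← ContinuousMultilinearMap.map_update_smul]
  change (p (n+1)) _ = (p (n+1)) _
  congr 1
  ext1 j
  refine Fin.succAboveCases k ?_ (fun i => ?_) j
  · simp [prX_apply, Prod.ext_iff]
  · have : k ≠ k.succAbove i := (Fin.succAbove_ne k i).symm
    by_cases h : k.succAbove i < k <;> simp [hm, h, this]

lemma exists_div {f : ℂ × ℂ → ℂ} (hf : AnalyticAt ℂ f 0) :
    ∃ G : ℂ × ℂ → ℂ, AnalyticAt ℂ G 0 ∧ ∀ᶠ z in 𝓝 (0 : ℂ × ℂ), f z = f (z.1, 0) + z.2 * G z := by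
  obtain ⟨p, r, hp⟩ := hf
  have hr := radius_divSer p (hp.r_pos.trans_le hp.r_le)
  have hq := (divSer p).hasFPowerSeriesOnBall hr
  refine ⟨(divSer p).sum, hq.analyticAt, ?_⟩
  have h1 : ∀ᶠ z in 𝓝 (0 : ℂ × ℂ), z ∈ Metric.eball (0 : ℂ × ℂ) r :=
    Metric.eball_mem_nhds _ hp.r_pos
  have h2 : ∀ᶠ z in 𝓝 (0 : ℂ × ℂ), z ∈ Metric.eball (0 : ℂ × ℂ) (divSer p).radius :=
    Metric.eball_mem_nhds _ hr
  have h3 : ∀ᶠ z in 𝓝 (0 : ℂ × ℂ), prX z ∈ Metric.eball (0 : ℂ × ℂ) r := by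
    have : Tendsto prX (𝓝 0) (𝓝 0) := by simpa using prX.continuous.tendsto 0
    exact this h1
  filter_upwards [h1, h2, h3] with z h1 h2 h3
  have s1 := hp.hasSum h1
  have s3 := hp.hasSum h3
  have s2 := (hq.hasSum h2).mul_left z.2
  rw [zero_add] at s1 s2 s3
  have s := s1.sub s3
  rw [← hasSum_nat_add_iff' 1] at s
  simp only [divSer_apply] at s2
  have := s2.unique s
  have e0 : (p 0 fun _ => z) = (p 0 fun _ => prX z) := by
    congr 1; ext1 i; exact i.elim0
  simp only [Finset.range_one, Finset.sum_singleton, e0, sub_self, sub_zero] at this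
  rw [this, prX_apply]; ring

lemma exists_root {E : Type*} [NormedAddCommGroup E] [NormedSpace ℂ E] {Q : E → ℂ} {z₀ : E}
    (hQ : AnalyticAt ℂ Q z₀) (h0 : Q z₀ ≠ 0) (n : ℕ) (hn : n ≠ 0) :
    ∃ R : E → ℂ, AnalyticAt ℂ R z₀ ∧ R z₀ ≠ 0 ∧ ∀ᶠ z in 𝓝 z₀, R z ^ n = Q z := by
  obtain ⟨c, hc⟩ := IsAlgClosed.exists_pow_nat_eq (Q z₀) (Nat.pos_of_ne_zero hn)
  have hc0 : c ≠ 0 := by rintro rfl; rw [zero_pow hn] at hc; exact h0 hc.symm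
  have hn' : (n : ℂ) ≠ 0 := Nat.cast_ne_zero.2 hn
  refine ⟨fun z => c * Complex.exp (Complex.log (Q z / Q z₀) / n), ?_, ?_, ?_⟩
  · have h1 : AnalyticAt ℂ (fun z => Q z / Q z₀) z₀ := hQ.div analyticAt_const h0
    have h2 : AnalyticAt ℂ (fun z => Complex.log (Q z / Q z₀)) z₀ := h1.clog (by simp [div_self h0])
    exact analyticAt_const.mul (h2.div analyticAt_const hn').cexp
  · exact mul_ne_zero hc0 (Complex.exp_ne_zero _)
  · filter_upwards [hQ.continuousAt.eventually_ne h0] with z hz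
    rw [mul_pow, hc, ← Complex.exp_nat_mul, mul_div_cancel₀ _ hn', Complex.exp_log (div_ne_zero hz h0),
      mul_div_cancel₀ _ h0]

lemma chart_of_coords {U : Set (ℂ × ℂ)} (hU : U ∈ 𝓝 (0 : ℂ × ℂ)) {ρ A B : ℂ × ℂ → ℂ}
    (N : ℂ × ℂ → ℂ)
    (hA : AnalyticAt ℂ A 0) (hB : AnalyticAt ℂ B 0) (hA0 : A 0 = 0) (hB0 : B 0 = 0) {a b : ℂ}
    (ha : a ≠ 0) (hb : b ≠ 0)
    (hA' : HasFDerivAt A (a • ContinuousLinearMap.fst ℂ ℂ ℂ) 0)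
    (hB' : HasFDerivAt B (b • ContinuousLinearMap.snd ℂ ℂ ℂ) 0)
    (hN : ∀ᶠ z in 𝓝 (0 : ℂ × ℂ), ρ z = N (A z, B z)) :
    ∃ (V : Set (ℂ × ℂ)) (φ : ℂ × ℂ → ℂ × ℂ),
      IsOpen V ∧ (0 : ℂ × ℂ) ∈ V ∧ AnalyticOnNhd ℂ φ V ∧ φ 0 = 0 ∧
      Set.InjOn φ V ∧ Set.MapsTo φ V U ∧ ∀ p ∈ V, ρ (φ p) = N p := by
  let L : (ℂ × ℂ) ≃L[ℂ] (ℂ × ℂ) :=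
    (ContinuousLinearEquiv.unitsEquivAut ℂ (Units.mk0 a ha)).prodCongr
      (ContinuousLinearEquiv.unitsEquivAut ℂ (Units.mk0 b hb))
  let Ψ : ℂ × ℂ → ℂ × ℂ := fun z => (A z, B z)
  have hΨ : ContDiffAt ℂ ⊤ Ψ 0 := (hA.prod hB).contDiffAt
  have hΨ' : HasFDerivAt Ψ (L : ℂ × ℂ →L[ℂ] ℂ × ℂ) 0 := by
    have h := hA'.prodMk hB'
    have e : (L : ℂ × ℂ →L[ℂ] ℂ × ℂ) = (a • ContinuousLinearMap.fst ℂ ℂ ℂ).prod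
        (b • ContinuousLinearMap.snd ℂ ℂ ℂ) := by
      ext <;> simp [L]
    rw [e]
    exact h
  have hΨ0 : Ψ 0 = 0 := by simp [Ψ, hA0, hB0]
  have hne : (⊤ : WithTop ℕ∞) ≠ 0 := by simp
  let e := hΨ.toOpenPartialHomeomorph Ψ hΨ' hne
  have he : (e : ℂ × ℂ → ℂ × ℂ) = Ψ := rfl
  have hs : (0 : ℂ × ℂ) ∈ e.source := hΨ.mem_toOpenPartialHomeomorph_source hΨ' hne
  have ht : (0 : ℂ × ℂ) ∈ e.target := by
    have := hΨ.image_mem_toOpenPartialHomeomorph_target hΨ' hne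
    rwa [hΨ0] at this
  have hφ0 : e.symm 0 = 0 := by
    have := e.left_inv hs
    rwa [he, hΨ0] at this
  have hφ : AnalyticAt ℂ e.symm 0 := by
    have := hΨ.to_localInverse hΨ' hne
    rw [hΨ0] at this
    exact this.analyticAt
  have htend : Tendsto e.symm (𝓝 0) (𝓝 0) := by
    have := hφ.continuousAt.tendsto
    rwa [hφ0] at this
  have hev : ∀ᶠ p in 𝓝 (0 : ℂ × ℂ), p ∈ e.target ∧ AnalyticAt ℂ e.symm p ∧ e.symm p ∈ U ∧
      ρ (e.symm p) = N (Ψ (e.symm p)) :=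
    (e.open_target.eventually_mem ht).and (hφ.eventually_analyticAt.and ((htend.eventually_mem hU).and (htend.eventually hN)))
  obtain ⟨V, hV, hVo, h0V⟩ := eventually_nhds_iff.1 hev
  refine ⟨V, e.symm, hVo, h0V, fun p hp => (hV p hp).2.1, hφ0,
    e.symm.injOn.mono fun p hp => (hV p hp).1, fun p hp => (hV p hp).2.2.1, fun p hp => ?_⟩
  rw [(hV p hp).2.2.2]
  congr 1
  exact e.right_inv (hV p hp).1

/-- The derivative of `m * b` at a zero of `m`. -/
lemma hasFDerivAt_mul_zero {m b : ℂ × ℂ → ℂ} {m' : ℂ × ℂ →L[ℂ] ℂ} (hm : HasFDerivAt m m' 0)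
    (h0 : m 0 = 0) (hb : AnalyticAt ℂ b 0) : HasFDerivAt (fun z => m z * b z) (b 0 • m') 0 := by
  have := hm.mul hb.differentiableAt.hasFDerivAt
  have e : m 0 • fderiv ℂ b 0 + b 0 • m' = b 0 • m' := by rw [h0]; ext <;> simp
  rw [← e]
  exact this

lemma two_le_order {f : ℂ → ℂ} (hf : AnalyticAt ℂ f 0) (h0 : f 0 = 0) (h1 : deriv f 0 = 0) :
    ((2 : ℕ) : ℕ∞) ≤ analyticOrderAt f 0 := by
  rw [natCast_le_analyticOrderAt_iff_iteratedDeriv_eq_zero hf]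
  intro i hi
  interval_cases i
  · simpa using h0
  · simpa [iteratedDeriv_one] using h1

lemma three_le_order {f : ℂ → ℂ} (hf : AnalyticAt ℂ f 0) (h0 : f 0 = 0) (h1 : deriv f 0 = 0)
    (h2 : iteratedDeriv 2 f 0 = 0) :
    ((3 : ℕ) : ℕ∞) ≤ analyticOrderAt f 0 := by
  rw [natCast_le_analyticOrderAt_iff_iteratedDeriv_eq_zero hf]
  intro i hi
  interval_cases i
  · simpa using h0
  · simpa [iteratedDeriv_one] using h1
  · exact h2

lemma hasDerivAt_sliceY {f : ℂ × ℂ → ℂ} {x y : ℂ} (hf : DifferentiableAt ℂ f (x, y)) :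
    HasDerivAt (fun t => f (x, t)) (fderiv ℂ f (x, y) (0, 1)) y := by
  have h : HasDerivAt (fun t : ℂ => (x, t)) ((0, 1) : ℂ × ℂ) y :=
    (hasDerivAt_const y x).prodMk (hasDerivAt_id y)
  exact hf.hasFDerivAt.comp_hasDerivAt y h

lemma hasDerivAt_sliceX {f : ℂ × ℂ → ℂ} {x y : ℂ} (hf : DifferentiableAt ℂ f (x, y)) :
    HasDerivAt (fun t => f (t, y)) (fderiv ℂ f (x, y) (1, 0)) x := by
  have h : HasDerivAt (fun t : ℂ => (t, y)) ((1, 0) : ℂ × ℂ) x :=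
    (hasDerivAt_id x).prodMk (hasDerivAt_const x y)
  exact hf.hasFDerivAt.comp_hasDerivAt x h

lemma tendsto_inl : Tendsto (fun x : ℂ => (x, (0 : ℂ))) (𝓝 0) (𝓝 (0 : ℂ × ℂ)) := by
  have : Continuous (fun x : ℂ => (x, (0 : ℂ))) := by fun_prop
  exact this.tendsto 0

lemma tendsto_inr : Tendsto (fun y : ℂ => ((0 : ℂ), y)) (𝓝 0) (𝓝 (0 : ℂ × ℂ)) := by
  have : Continuous (fun y : ℂ => ((0 : ℂ), y)) := by fun_prop
  exact this.tendsto 0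

/-- Splitting off the critical curve. -/
lemma exists_splitting {ρ : ℂ × ℂ → ℂ} (hρ : AnalyticAt ℂ ρ 0)
    (h01 : fderiv ℂ ρ 0 (0, 1) = 0)
    (h11 : fderiv ℂ (fun z => fderiv ℂ ρ z (0, 1)) 0 (1, 0) = 0)
    (h02 : fderiv ℂ (fun z => fderiv ℂ ρ z (0, 1)) 0 (0, 1) ≠ 0) :
    ∃ (g : ℂ → ℂ) (Q : ℂ × ℂ → ℂ), AnalyticAt ℂ g 0 ∧ g 0 = 0 ∧ deriv g 0 = 0 ∧
      AnalyticAt ℂ Q 0 ∧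
      ∀ᶠ z in 𝓝 (0 : ℂ × ℂ), ρ (z.1, g z.1 + z.2) = ρ (z.1, g z.1) + z.2 ^ 2 * Q z := by
  set ρy : ℂ × ℂ → ℂ := fun z => fderiv ℂ ρ z (0, 1) with hρy
  have hρya : AnalyticAt ℂ ρy 0 :=
    ((ContinuousLinearMap.apply ℂ ℂ ((0, 1) : ℂ × ℂ)).analyticAt _).comp hρ.fderiv
  have hcd : ContDiffAt ℂ ⊤ ρy ((0 : ℂ), (0 : ℂ)) := hρya.contDiffAt
  have hne : (⊤ : WithTop ℕ∞) ≠ 0 := by simp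
  have hinv : (fderiv ℂ ρy ((0 : ℂ), (0 : ℂ)) ∘L .inr ℂ ℂ ℂ).IsInvertible := by
    refine ⟨ContinuousLinearEquiv.unitsEquivAut ℂ (Units.mk0 _ h02), ?_⟩
    ext
    simp
    rfl
  let g := hcd.implicitFunction hne hinv
  have hg0 : g 0 = 0 := hcd.implicitFunction_apply_self hne hinv
  have hga : AnalyticAt ℂ g 0 := (hcd.contDiffAt_implicitFunction hne hinv).analyticAt
  have hgeq : ∀ᶠ x in 𝓝 (0 : ℂ), ρy (x, g x) = 0 := by
    have := hcd.eventually_apply_implicitFunction hne hinv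
    filter_upwards [this] with x hx
    exact hx.trans h01
  have hg1 : deriv g 0 = 0 := by
    have hd : HasDerivAt (fun x => (x, g x)) ((1, deriv g 0) : ℂ × ℂ) 0 :=
      (hasDerivAt_id (0 : ℂ)).prodMk hga.differentiableAt.hasDerivAt
    have hf : HasFDerivAt ρy (fderiv ℂ ρy 0) ((0 : ℂ), g 0) := by
      rw [hg0]; exact hρya.differentiableAt.hasFDerivAt
    have h1 := hf.comp_hasDerivAt (0 : ℂ) hd
    have h2 : HasDerivAt (ρy ∘ fun x => (x, g x)) 0 (0 : ℂ) :=
      (hasDerivAt_const (0 : ℂ) (0 : ℂ)).congr_of_eventuallyEq hgeq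
    have h3 := h1.unique h2
    have e : ((1, deriv g 0) : ℂ × ℂ) = (1, 0) + deriv g 0 • (0, 1) := by simp
    rw [e, map_add, map_smul, h11, zero_add, smul_eq_mul] at h3
    exact (mul_eq_zero.1 h3).resolve_right h02
  -- the sheared function
  let S : ℂ × ℂ → ℂ × ℂ := fun z => (z.1, g z.1 + z.2)
  have hS0 : S 0 = 0 := by simp [S, hg0]
  have hga' : AnalyticAt ℂ (fun z : ℂ × ℂ => g z.1) 0 :=
    AnalyticAt.fun_comp (f := fun z : ℂ × ℂ => z.1) (g := g) hga analyticAt_fst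
  have hSa : AnalyticAt ℂ S 0 := analyticAt_fst.prod (hga'.add analyticAt_snd)
  have hFa : AnalyticAt ℂ (fun z => ρ (S z)) 0 :=
    AnalyticAt.fun_comp (g := ρ) (f := S) (by rwa [hS0]) hSa
  obtain ⟨G, hG, hFG⟩ := exists_div hFa
  obtain ⟨Q, hQ, hGQ⟩ := exists_div hG
  have hG0 : ∀ᶠ x in 𝓝 (0 : ℂ), G (x, 0) = 0 := by
    have hSt : Tendsto S (𝓝 0) (𝓝 0) := by
      have := hSa.continuousAt.tendsto
      rwa [hS0] at this
    filter_upwards [tendsto_inl.eventually hFG.eventually_nhds,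
      tendsto_inl.eventually hG.eventually_analyticAt, hgeq,
      tendsto_inl.eventually (hSt.eventually hρ.eventually_analyticAt)] with x h1 h2 h3 h4
    have c : Tendsto (fun t : ℂ => (x, t)) (𝓝 0) (𝓝 (x, 0)) := by
      have : Continuous (fun t : ℂ => (x, t)) := by fun_prop
      exact this.tendsto 0
    have d1 : HasDerivAt (fun t => ρ (S (x, t))) 0 0 := by
      have h5 := hasDerivAt_sliceY (f := ρ) (x := x) (y := g x + 0) h4.differentiableAt
      have h6 := h5.comp_const_add (g x) 0
      have h7 : fderiv ℂ ρ (x, g x + 0) (0, 1) = 0 := by rw [add_zero]; exact h3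
      rw [h7] at h6
      exact h6
    have d2 : HasDerivAt (fun t => ρ (S (x, 0)) + t * G (x, t)) (G (x, 0)) 0 := by
      have h5 := (hasDerivAt_id (0 : ℂ)).mul (hasDerivAt_sliceY (f := G) h2.differentiableAt)
      have h6 := h5.const_add (ρ (S (x, 0)))
      simpa using h6
    have d3 := d2.congr_of_eventuallyEq (c.eventually h1)
    exact d3.unique d1
  refine ⟨g, Q, hga, hg0, hg1, hQ, ?_⟩
  have hfst : Tendsto (fun z : ℂ × ℂ => z.1) (𝓝 0) (𝓝 0) := continuous_fst.tendsto (0 : ℂ × ℂ)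
  filter_upwards [hFG, hGQ, hfst.eventually hG0] with z h1 h2 h3
  rw [h2, h3] at h1
  simp only [S, add_zero] at h1
  rw [h1]; ring

theorem stmt_2 (U : Set (ℂ × ℂ)) (hU : IsOpen U) (h0U : (0 : ℂ × ℂ) ∈ U)
    (ρ : ℂ × ℂ → ℂ) (hρ : AnalyticOnNhd ℂ ρ U)
    (h00 : pd 0 0 ρ = 0) (h10 : pd 1 0 ρ = 0) (h01 : pd 0 1 ρ = 0)
    (h20 : pd 2 0 ρ = 0) (h11 : pd 1 1 ρ = 0) (h02 : pd 0 2 ρ ≠ 0) :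
    ∃ (V : Set (ℂ × ℂ)) (φ : ℂ × ℂ → ℂ × ℂ),
      IsOpen V ∧ (0 : ℂ × ℂ) ∈ V ∧ AnalyticOnNhd ℂ φ V ∧ φ 0 = 0 ∧
      Set.InjOn φ V ∧ Set.MapsTo φ V U ∧
      ((∀ p ∈ V, ρ (φ p) = p.2 ^ 2) ∨
        ∃ k : ℕ, 2 ≤ k ∧ ∀ p ∈ V, ρ (φ p) = p.2 ^ 2 + p.1 ^ (k + 1)) := by
  have hρ0 : AnalyticAt ℂ ρ 0 := hρ 0 h0U
  have hUn : U ∈ 𝓝 (0 : ℂ × ℂ) := hU.mem_nhds h0U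
  -- translate the partial derivatives
  have z00 : ρ ((0 : ℂ), (0 : ℂ)) = 0 := by simpa [pd] using h00
  have hX : AnalyticAt ℂ (fun x : ℂ => ρ (x, 0)) 0 :=
    AnalyticAt.fun_comp (g := ρ) (f := fun x : ℂ => (x, (0 : ℂ))) hρ0
      (analyticAt_id.prod analyticAt_const)
  have hY : AnalyticAt ℂ (fun y : ℂ => ρ (0, y)) 0 :=
    AnalyticAt.fun_comp (g := ρ) (f := fun y : ℂ => ((0 : ℂ), y)) hρ0
      (analyticAt_const.prod analyticAt_id)
  have z10 : deriv (fun x : ℂ => ρ (x, 0)) 0 = 0 := by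
    simpa [pd, iteratedDeriv_one] using h10
  have z20 : iteratedDeriv 2 (fun x : ℂ => ρ (x, 0)) 0 = 0 := by
    simpa [pd] using h20
  have z01' : deriv (fun y : ℂ => ρ (0, y)) 0 = 0 := by
    simpa [pd, iteratedDeriv_one] using h01
  have z02' : iteratedDeriv 2 (fun y : ℂ => ρ (0, y)) 0 ≠ 0 := by
    simpa [pd] using h02
  have z01 : fderiv ℂ ρ 0 (0, 1) = 0 := by
    exact (hasDerivAt_sliceY (f := ρ) (x := 0) (y := 0) hρ0.differentiableAt).deriv.symm.trans z01'
  have hρya : AnalyticAt ℂ (fun z => fderiv ℂ ρ z (0, 1)) 0 :=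
    ((ContinuousLinearMap.apply ℂ ℂ ((0, 1) : ℂ × ℂ)).analyticAt _).comp hρ0.fderiv
  have z11 : fderiv ℂ (fun z => fderiv ℂ ρ z (0, 1)) 0 (1, 0) = 0 := by
    have e : (fun x => iteratedDeriv 1 (fun y => ρ (x, y)) 0) =ᶠ[𝓝 0]
        fun x => fderiv ℂ ρ (x, 0) (0, 1) := by
      filter_upwards [tendsto_inl.eventually hρ0.eventually_analyticAt] with x hx
      rw [iteratedDeriv_one]
      exact (hasDerivAt_sliceY hx.differentiableAt).deriv
    rw [pd, iteratedDeriv_one, e.deriv_eq] at h11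
    refine Eq.trans ?_ h11
    exact (hasDerivAt_sliceX (f := fun z => fderiv ℂ ρ z (0, 1)) (x := 0) (y := 0)
      hρya.differentiableAt).deriv.symm
  have z02 : fderiv ℂ (fun z => fderiv ℂ ρ z (0, 1)) 0 (0, 1) ≠ 0 := by
    have e : (deriv fun y => ρ (0, y)) =ᶠ[𝓝 0] fun y => fderiv ℂ ρ (0, y) (0, 1) := by
      filter_upwards [tendsto_inr.eventually hρ0.eventually_analyticAt] with y hy
      exact (hasDerivAt_sliceY hy.differentiableAt).deriv
    rw [iteratedDeriv_succ, iteratedDeriv_one, e.deriv_eq] at z02'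
    intro hc
    apply z02'
    refine Eq.trans ?_ hc
    exact (hasDerivAt_sliceY (f := fun z => fderiv ℂ ρ z (0, 1)) (x := 0) (y := 0)
      hρya.differentiableAt).deriv
  obtain ⟨g, Q, hg, hg0, hg1, hQ, hsplit⟩ := exists_splitting hρ0 z01 z11 z02
  -- `Q` does not vanish at the origin
  have hQ0 : Q 0 ≠ 0 := by
    intro hc
    apply z02'
    have hq : AnalyticAt ℂ (fun t : ℂ => Q (0, t)) 0 :=
      AnalyticAt.fun_comp (g := Q) (f := fun y : ℂ => ((0 : ℂ), y)) hQ
        (analyticAt_const.prod analyticAt_id)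
    obtain ⟨q, hqa, hqe⟩ := (natCast_le_analyticOrderAt (n := 1) hq).1 (by
      rw [natCast_le_analyticOrderAt_iff_iteratedDeriv_eq_zero hq]
      intro i hi
      interval_cases i
      simpa [Prod.mk_zero_zero] using hc)
    refine (natCast_le_analyticOrderAt_iff_iteratedDeriv_eq_zero (n := 3) hY).1 ?_ 2 (by norm_num)
    rw [natCast_le_analyticOrderAt hY]
    refine ⟨q, hqa, ?_⟩
    filter_upwards [hqe, tendsto_inr.eventually hsplit] with t h1 h2
    simp only [hg0, zero_add, z00] at h2
    rw [h2, h1]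
    simp only [smul_eq_mul, sub_zero]
    ring
  obtain ⟨b, hb, hb0, hbQ⟩ := exists_root hQ hQ0 2 two_ne_zero
  -- the reduced function of one variable
  have hcurve : AnalyticAt ℂ (fun x : ℂ => (x, g x)) 0 := analyticAt_id.prod hg
  have hh : AnalyticAt ℂ (fun x => ρ (x, g x)) 0 :=
    AnalyticAt.fun_comp (g := ρ) (f := fun x : ℂ => (x, g x)) (by simpa [hg0, Prod.mk_zero_zero] using hρ0) hcurve
  have hcurve' : AnalyticAt ℂ (fun x : ℂ => (x, -g x)) 0 := analyticAt_id.prod hg.neg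
  have hQc : AnalyticAt ℂ (fun x => Q (x, -g x)) 0 :=
    AnalyticAt.fun_comp (g := Q) (f := fun x : ℂ => (x, -g x)) (by simpa [hg0, Prod.mk_zero_zero] using hQ) hcurve'
  have hcurve't : Tendsto (fun x : ℂ => (x, -g x)) (𝓝 0) (𝓝 0) := by
    have := hcurve'.continuousAt.tendsto
    simpa [hg0, Prod.mk_zero_zero] using this
  have hord : ((3 : ℕ) : ℕ∞) ≤ analyticOrderAt (fun x => ρ (x, g x)) 0 := by
    obtain ⟨r, hr, hre⟩ := (natCast_le_analyticOrderAt hX).1 (three_le_order hX z00 z10 z20)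
    obtain ⟨s, hs, hse⟩ := (natCast_le_analyticOrderAt hg).1 (two_le_order hg hg0 hg1)
    rw [natCast_le_analyticOrderAt hh]
    refine ⟨fun x => r x - x * s x ^ 2 * Q (x, -g x),
      hr.sub ((analyticAt_id.mul (hs.pow 2)).mul hQc), ?_⟩
    filter_upwards [hre, hse, hcurve't.eventually hsplit] with x h1 h2 h3
    simp only [add_neg_cancel, smul_eq_mul, sub_zero] at h1 h2 h3 ⊢
    have h4 : ρ (x, g x) = ρ (x, 0) - (-g x) ^ 2 * Q (x, -g x) := by rw [h3]; ring
    rw [h4, h1, neg_sq]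
    nth_rewrite 1 [h2]
    ring
  -- the second coordinate
  have hg' : AnalyticAt ℂ (fun z : ℂ × ℂ => g z.1) 0 :=
    AnalyticAt.fun_comp (f := fun z : ℂ × ℂ => z.1) (g := g) hg analyticAt_fst
  have hT : AnalyticAt ℂ (fun z : ℂ × ℂ => (z.1, z.2 - g z.1)) 0 :=
    analyticAt_fst.prod (analyticAt_snd.sub hg')
  have hTt : Tendsto (fun z : ℂ × ℂ => (z.1, z.2 - g z.1)) (𝓝 0) (𝓝 0) := by
    have := hT.continuousAt.tendsto
    simpa [hg0, Prod.mk_zero_zero] using this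
  have hbT : AnalyticAt ℂ (fun z : ℂ × ℂ => b (z.1, z.2 - g z.1)) 0 :=
    AnalyticAt.fun_comp (g := b) (f := fun z : ℂ × ℂ => (z.1, z.2 - g z.1))
      (by simpa [hg0, Prod.mk_zero_zero] using hb) hT
  have hbT0 : b ((0 : ℂ × ℂ).1, (0 : ℂ × ℂ).2 - g (0 : ℂ × ℂ).1) ≠ 0 := by
    simpa [hg0, Prod.mk_zero_zero] using hb0
  have hm : HasFDerivAt (fun z : ℂ × ℂ => z.2 - g z.1) (ContinuousLinearMap.snd ℂ ℂ ℂ) 0 := by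
    have hgd : HasDerivAt g 0 (0 : ℂ × ℂ).1 := by
      have := hg.differentiableAt.hasDerivAt
      rwa [hg1] at this
    have h1 : HasFDerivAt (fun z : ℂ × ℂ => g z.1) ((0 : ℂ) • ContinuousLinearMap.fst ℂ ℂ ℂ) 0 :=
      hgd.comp_hasFDerivAt (0 : ℂ × ℂ) (hasFDerivAt_fst (𝕜 := ℂ) (E := ℂ) (F := ℂ))
    have h2 := (hasFDerivAt_snd (𝕜 := ℂ) (E := ℂ) (F := ℂ) (p := 0)).sub h1
    have e : ContinuousLinearMap.snd ℂ ℂ ℂ - (0 : ℂ) • ContinuousLinearMap.fst ℂ ℂ ℂ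
        = ContinuousLinearMap.snd ℂ ℂ ℂ := by ext <;> simp
    rw [← e]
    exact h2
  have hB : AnalyticAt ℂ (fun z : ℂ × ℂ => (z.2 - g z.1) * b (z.1, z.2 - g z.1)) 0 :=
    (analyticAt_snd.sub hg').mul hbT
  have hB0 : (fun z : ℂ × ℂ => (z.2 - g z.1) * b (z.1, z.2 - g z.1)) 0 = 0 := by simp [hg0]
  have hB' := hasFDerivAt_mul_zero hm (by simp [hg0]) hbT
  have hform : ∀ᶠ z in 𝓝 (0 : ℂ × ℂ),
      ρ z = ((z.2 - g z.1) * b (z.1, z.2 - g z.1)) ^ 2 + ρ (z.1, g z.1) := by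
    filter_upwards [hTt.eventually hsplit, hTt.eventually hbQ] with z h1 h2
    simp only [add_sub_cancel] at h1
    rw [mul_pow, h2, ← Prod.mk.eta (p := z), h1]
    ring
  have hfst : Tendsto (fun z : ℂ × ℂ => z.1) (𝓝 0) (𝓝 0) := continuous_fst.tendsto (0 : ℂ × ℂ)
  by_cases htop : analyticOrderAt (fun x => ρ (x, g x)) 0 = ⊤
  · rw [analyticOrderAt_eq_top] at htop
    obtain ⟨V, φ, h1, h2, h3, h4, h5, h6, h7⟩ := chart_of_coords hUn (ρ := ρ)
      (A := fun z : ℂ × ℂ => z.1) (fun p => p.2 ^ 2) analyticAt_fst hB rfl hB0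
      one_ne_zero hbT0 (by rw [one_smul]; exact hasFDerivAt_fst) hB' (by
        filter_upwards [hform, hfst.eventually htop] with z e1 e2
        rw [e1, e2, add_zero])
    exact ⟨V, φ, h1, h2, h3, h4, h5, h6, Or.inl h7⟩
  · obtain ⟨n, hn⟩ := ENat.ne_top_iff_exists.1 htop
    rw [← hn, Nat.cast_le] at hord
    obtain ⟨c, hc, hc0, hce⟩ := hh.analyticOrderAt_eq_natCast.1 hn.symm
    obtain ⟨r, hr, hr0, hrc⟩ := exists_root hc hc0 n (by omega)
    have hr' : AnalyticAt ℂ (fun z : ℂ × ℂ => r z.1) 0 :=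
      AnalyticAt.fun_comp (f := fun z : ℂ × ℂ => z.1) (g := r) hr analyticAt_fst
    obtain ⟨V, φ, h1, h2, h3, h4, h5, h6, h7⟩ := chart_of_coords hUn (ρ := ρ)
      (A := fun z : ℂ × ℂ => z.1 * r z.1) (fun p => p.2 ^ 2 + p.1 ^ n)
      (analyticAt_fst.mul hr') hB (by simp) hB0 hr0 hbT0
      (hasFDerivAt_mul_zero hasFDerivAt_fst rfl hr') hB' (by
        filter_upwards [hform, hfst.eventually hce, hfst.eventually hrc] with z e1 e2 e3
        rw [e1, e2, ← e3, smul_eq_mul, sub_zero, ← mul_pow z.1])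
    refine ⟨V, φ, h1, h2, h3, h4, h5, h6, Or.inr ⟨n - 1, by omega, ?_⟩⟩
    rw [Nat.sub_add_cancel (by omega)]
    exact h7
end

section
/- Let ρ be holomorphic near 0 in ℂ² with ρ and all its first and second partial derivatives vanishing at the origin, and suppose the cubic form ∇³ρ|₀ is nondegenerate in the sense that there is no nonzero vector w ∈ ℂ² with ∇³ρ|₀(w,w,·) = 0. Then there exists a holomorphic coordinate chart (u,v) centered at the origin with ρ(u,v) = u³ + v³. -/
open Filter Topology

theorem D4.clm {A : ℂ × ℂ → (ℂ × ℂ →L[ℂ] ℂ)} {a : ℂ × ℂ} (hA : AnalyticAt ℂ A a) (v : ℂ × ℂ) :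
    AnalyticAt ℂ (fun z => A z v) a :=
  AnalyticAt.fun_comp (g := ContinuousLinearMap.apply ℂ ℂ v)
    (ContinuousLinearMap.analyticAt _ _) hA

theorem D4.hadamard {f : ℂ × ℂ → ℂ} (hf : AnalyticAt ℂ f 0) :
    ∃ A B : ℂ × ℂ → ℂ, AnalyticAt ℂ A 0 ∧ AnalyticAt ℂ B 0 ∧
      f =ᶠ[𝓝 0] fun z => f 0 + (z.1 * A z + z.2 * B z) := by
  obtain ⟨p, r, hp⟩ := hf
  have hr : 0 < p.shift.radius := by
    rw [p.radius_shift]; exact hp.r_pos.trans_le hp.r_le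
  have hA : AnalyticAt ℂ p.shift.sum 0 := (p.shift.hasFPowerSeriesOnBall hr).analyticAt
  refine ⟨fun z => p.shift.sum z (1, 0), fun z => p.shift.sum z (0, 1), ?_, ?_, ?_⟩
  · exact D4.clm hA _
  · exact D4.clm hA _
  · filter_upwards [Metric.eball_mem_nhds (0 : ℂ × ℂ) hp.r_pos] with z hz
    have h1 := hp.hasSum hz
    have hz' : z ∈ Metric.eball (0 : ℂ × ℂ) p.shift.radius := by
      rw [p.radius_shift]; exact Metric.eball_subset_eball hp.r_le hz
    have h2 := p.shift.hasSum hz'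
    have h3 := h2.mapL (ContinuousLinearMap.apply ℂ ℂ z)
    have h4 : HasSum (fun n => p (n + 1) fun _ => z) (p.shift.sum z z) := by
      have he : (fun n => p (n + 1) fun _ => z) = fun n => (p.shift n fun _ => z) z := by
        funext n
        simp only [FormalMultilinearSeries.shift, ContinuousMultilinearMap.curryRight_apply]
        congr 1
        funext i
        refine Fin.lastCases ?_ (fun j => ?_) i <;> simp
      rw [he]
      exact h3
    have h5 := (hasSum_nat_add_iff' 1).2 h1
    have h6 := h5.unique h4
    have h7 : p 0 (fun _ => z) = f 0 := hp.coeff_zero _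
    simp only [zero_add, Finset.range_one, Finset.sum_singleton, h7] at h6
    have hz3 : z = z.1 • ((1 : ℂ), (0 : ℂ)) + z.2 • ((0 : ℂ), (1 : ℂ)) := by
      ext <;> simp
    have h8 : p.shift.sum z z = z.1 * p.shift.sum z (1, 0) + z.2 * p.shift.sum z (0, 1) := by
      conv_lhs => rw [show p.shift.sum z z = p.shift.sum z (z.1 • ((1 : ℂ), (0 : ℂ)) + z.2 • ((0 : ℂ), (1 : ℂ))) from congrArg _ hz3]
      simp only [map_add, map_smul, smul_eq_mul]
    rw [← h8, ← h6]; ring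

theorem D4.inv {E : Type*} [NormedAddCommGroup E] [NormedSpace ℂ E] [FiniteDimensional ℂ E]
    {f : E → E} {a : E} {f' : E →L[ℂ] E} (hf : AnalyticAt ℂ f a) (hf' : HasFDerivAt f f' a)
    (hinj : ∀ v, f' v = 0 → v = 0) :
    ∃ g : E → E, AnalyticAt ℂ g (f a) ∧ g (f a) = a ∧ ∀ᶠ y in 𝓝 (f a), f (g y) = y := by
  have : CompleteSpace E := FiniteDimensional.complete ℂ E
  have hi : Function.Injective (f' : E →ₗ[ℂ] E) := by
    rw [injective_iff_map_eq_zero]; exact hinj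
  let e : E ≃L[ℂ] E := (LinearEquiv.ofInjectiveEndo (f' : E →ₗ[ℂ] E) hi).toContinuousLinearEquiv
  have he : (e : E →L[ℂ] E) = f' := by ext v; rfl
  have hfe : HasFDerivAt f (e : E →L[ℂ] E) a := by rw [he]; exact hf'
  have hc : ContDiffAt ℂ ⊤ f a := hf.contDiffAt
  refine ⟨hc.localInverse hfe (by simp), ?_, hc.localInverse_apply_image hfe _, ?_⟩
  · exact ContDiffAt.analyticAt (hc.to_localInverse hfe (by simp))
  · exact (hc.hasStrictFDerivAt' hfe (by simp)).eventually_right_inverse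

theorem D4.leib {g : ℂ → ℂ} (hg : AnalyticAt ℂ g 0) (n : ℕ) :
    iteratedDeriv n (fun y => y * g y) 0 = n * iteratedDeriv (n - 1) g 0 := by
  have h := iteratedDeriv_mul (n := n) (f := fun y : ℂ => y) (g := g) (x := 0)
    contDiffAt_id hg.contDiffAt
  have e : (fun y => y * g y) = (fun y : ℂ => y) * g := rfl
  rw [e, h]
  have hid : ∀ i, iteratedDeriv i (fun y : ℂ => y) 0 = if i = 1 then 1 else 0 := by
    intro i
    have := @iteratedDeriv_id ℂ _ i 0
    rw [show (fun y : ℂ => y) = id from rfl, this]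
    rcases i with _ | _ | i <;> simp
  simp only [hid]
  rcases n with _ | n
  · simp
  · rw [Finset.sum_eq_single 1]
    · simp
    · intro b _ hb; simp [hb]
    · simp

theorem D4.slice {f : ℂ × ℂ → ℂ} {x y : ℂ} (hf : AnalyticAt ℂ f (x, y)) :
    AnalyticAt ℂ (fun t => f (x, t)) y :=
  AnalyticAt.fun_comp (g := f) (f := fun t => (x, t)) hf (analyticAt_const.prod analyticAt_id)

theorem D4.tend : Tendsto (fun x : ℂ => (x, (0 : ℂ))) (𝓝 0) (𝓝 0) := by
  have : Continuous (fun x : ℂ => (x, (0 : ℂ))) := by fun_prop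
  exact this.tendsto' 0 0 rfl

theorem D4.evslice {f : ℂ × ℂ → ℂ} (hf : AnalyticAt ℂ f 0) :
    ∀ᶠ x in 𝓝 (0 : ℂ), AnalyticAt ℂ (fun t => f (x, t)) 0 :=
  (D4.tend.eventually hf.eventually_analyticAt).mono fun _ h => D4.slice h

theorem D4.Y_analytic (j : ℕ) : ∀ {f : ℂ × ℂ → ℂ}, AnalyticAt ℂ f 0 →
    AnalyticAt ℂ (fun x => iteratedDeriv j (fun y => f (x, y)) 0) 0 := by
  induction j with
  | zero =>
    intro f hf
    simp only [iteratedDeriv_zero]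
    exact AnalyticAt.fun_comp (g := f) (f := fun t => (t, (0 : ℂ))) hf (analyticAt_id.prod analyticAt_const)
  | succ j ih =>
    intro f hf
    have h2 : AnalyticAt ℂ (fun p => fderiv ℂ f p (0, 1)) 0 := D4.clm hf.fderiv _
    refine (ih h2).congr ?_
    filter_upwards [D4.tend.eventually hf.eventually_analyticAt.eventually_nhds] with x hx
    rw [iteratedDeriv_succ']
    apply Filter.EventuallyEq.iteratedDeriv_eq
    have ht : Tendsto (fun y : ℂ => (x, y)) (𝓝 0) (𝓝 (x, 0)) :=
      (Continuous.prodMk continuous_const continuous_id).tendsto' _ _ rfl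
    filter_upwards [ht.eventually hx] with y hy
    have h1 : HasFDerivAt f (fderiv ℂ f (x, y)) (x, y) := hy.differentiableAt.hasFDerivAt
    have h3 : HasDerivAt (fun t : ℂ => (x, t)) (0, 1) y :=
      (hasDerivAt_const y x).prodMk (hasDerivAt_id y)
    exact (HasFDerivAt.comp_hasDerivAt y h1 h3).deriv.symm

theorem D4.pd_congr {f g : ℂ × ℂ → ℂ} (h : f =ᶠ[𝓝 0] g) (i j : ℕ) : pd i j f = pd i j g := by
  apply Filter.EventuallyEq.iteratedDeriv_eq
  filter_upwards [D4.tend.eventually h.eventually_nhds] with x hx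
  apply Filter.EventuallyEq.iteratedDeriv_eq
  have ht : Tendsto (fun y : ℂ => (x, y)) (𝓝 0) (𝓝 (x, 0)) :=
      (Continuous.prodMk continuous_const continuous_id).tendsto' _ _ rfl
  exact ht.eventually hx

theorem D4.pd_add {f g : ℂ × ℂ → ℂ} (hf : AnalyticAt ℂ f 0) (hg : AnalyticAt ℂ g 0) (i j : ℕ) :
    pd i j (fun z => f z + g z) = pd i j f + pd i j g := by
  unfold pd
  rw [← iteratedDeriv_add (D4.Y_analytic j hf).contDiffAt (D4.Y_analytic j hg).contDiffAt]
  apply Filter.EventuallyEq.iteratedDeriv_eq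
  filter_upwards [D4.evslice hf, D4.evslice hg] with x h1 h2
  exact iteratedDeriv_add h1.contDiffAt h2.contDiffAt

theorem D4.pd_x {g : ℂ × ℂ → ℂ} (hg : AnalyticAt ℂ g 0) (i j : ℕ) :
    pd i j (fun z => z.1 * g z) = i * pd (i - 1) j g := by
  unfold pd
  rw [← D4.leib (D4.Y_analytic j hg)]
  congr 1
  ext x
  exact iteratedDeriv_const_mul_field x _

theorem D4.pd_y {g : ℂ × ℂ → ℂ} (hg : AnalyticAt ℂ g 0) (i j : ℕ) :
    pd i j (fun z => z.2 * g z) = j * pd i (j - 1) g := by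
  unfold pd
  rw [← iteratedDeriv_const_mul_field (j : ℂ)]
  apply Filter.EventuallyEq.iteratedDeriv_eq
  filter_upwards [D4.evslice hg] with x h1
  exact D4.leib h1 j

theorem D4.pd_const (c : ℂ) (i j : ℕ) :
    pd i j (fun _ => c) = if i = 0 ∧ j = 0 then c else 0 := by
  unfold pd
  rcases j with _ | j
  · rcases i with _ | i <;> simp [iteratedDeriv_const]
  · simp [iteratedDeriv_const]

theorem D4.pd_zero (f : ℂ × ℂ → ℂ) : pd 0 0 f = f 0 := by
  simp [pd]; rfl

theorem D4.step {f : ℂ × ℂ → ℂ} (hf : AnalyticAt ℂ f 0) :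
    ∃ A B : ℂ × ℂ → ℂ, AnalyticAt ℂ A 0 ∧ AnalyticAt ℂ B 0 ∧
      (f =ᶠ[𝓝 0] fun z => f 0 + (z.1 * A z + z.2 * B z)) ∧
      ∀ i j, pd i j f = (if i = 0 ∧ j = 0 then f 0 else 0) +
        (i * pd (i - 1) j A + j * pd i (j - 1) B) := by
  obtain ⟨A, B, hA, hB, h⟩ := D4.hadamard hf
  refine ⟨A, B, hA, hB, h, fun i j => ?_⟩
  have h1 : AnalyticAt ℂ (fun z : ℂ × ℂ => z.1 * A z) 0 := analyticAt_fst.mul hA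
  have h2 : AnalyticAt ℂ (fun z : ℂ × ℂ => z.2 * B z) 0 := analyticAt_snd.mul hB
  rw [D4.pd_congr h, D4.pd_add (f := fun _ => f 0) (g := fun z => z.1 * A z + z.2 * B z)
    analyticAt_const (h1.add h2), D4.pd_const, D4.pd_add h1 h2,
    D4.pd_x hA, D4.pd_y hB]

theorem D4.decomp {f : ℂ × ℂ → ℂ} (hf : AnalyticAt ℂ f 0)
    (hlow : ∀ i j : ℕ, i + j ≤ 2 → pd i j f = 0) :
    ∃ a b c d : ℂ × ℂ → ℂ, AnalyticAt ℂ a 0 ∧ AnalyticAt ℂ b 0 ∧ AnalyticAt ℂ c 0 ∧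
      AnalyticAt ℂ d 0 ∧
      (f =ᶠ[𝓝 0] fun z => z.1 ^ 3 * a z + z.1 ^ 2 * z.2 * b z + z.1 * z.2 ^ 2 * c z
        + z.2 ^ 3 * d z) ∧
      pd 3 0 f = 6 * a 0 ∧ pd 2 1 f = 2 * b 0 ∧ pd 1 2 f = 2 * c 0 ∧ pd 0 3 f = 6 * d 0 := by
  obtain ⟨A, B, hA, hB, hfe, hfp⟩ := D4.step hf
  obtain ⟨A1, A2, hA1, hA2, hAe, hAp⟩ := D4.step hA
  obtain ⟨B1, B2, hB1, hB2, hBe, hBp⟩ := D4.step hB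
  obtain ⟨a1, a2, ha1, ha2, hae, hap⟩ := D4.step hA1
  have hE := hA2.add hB1
  have hEp : ∀ i j, pd i j (A2 + B1) = pd i j A2 + pd i j B1 := D4.pd_add hA2 hB1
  obtain ⟨e1, e2, he1, he2, hee, hep⟩ := D4.step hE
  obtain ⟨b1, b2, hb1, hb2, hbe, hbp⟩ := D4.step hB2
  have f0 : f 0 = 0 := by rw [← D4.pd_zero f]; exact hlow 0 0 (by norm_num)
  have A0 : A 0 = 0 := by
    have h := hlow 1 0 (by norm_num)
    rw [hfp] at h; simpa [D4.pd_zero] using h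
  have B0 : B 0 = 0 := by
    have h := hlow 0 1 (by norm_num)
    rw [hfp] at h; simpa [D4.pd_zero] using h
  have A10 : A1 0 = 0 := by
    have h := hlow 2 0 (by norm_num)
    rw [hfp, hAp] at h; simpa [D4.pd_zero] using h
  have E0 : (A2 + B1) 0 = 0 := by
    have h := hlow 1 1 (by norm_num)
    rw [hfp, hAp, hBp] at h; simpa [D4.pd_zero] using h
  have B20 : B2 0 = 0 := by
    have h := hlow 0 2 (by norm_num)
    rw [hfp, hBp] at h; simpa [D4.pd_zero] using h
  refine ⟨a1, fun z => a2 z + e1 z, fun z => e2 z + b1 z, b2, ha1, ha2.add he1, he2.add hb1, hb2,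
    ?_, ?_, ?_, ?_, ?_⟩
  · filter_upwards [hfe, hAe, hBe, hae, hee, hbe] with z h1 h2 h3 h4 h5 h6
    simp only [Pi.add_apply] at h5 E0
    rw [E0] at h5
    rw [h1, h2, h3, h4, h6, f0, A0, B0, A10, B20]
    linear_combination z.1 * z.2 * h5
  · rw [hfp, hAp, hap]; simp [D4.pd_zero]; ring
  · have h1 := hEp 1 0
    rw [hep] at h1
    have h2 := hap 0 1
    simp [D4.pd_zero] at h1 h2
    rw [hfp, hAp, hBp]; simp [D4.pd_zero]; rw [h2]
    linear_combination (-2) * h1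
  · have h1 := hEp 0 1
    rw [hep] at h1
    have h2 := hbp 1 0
    simp [D4.pd_zero] at h1 h2
    rw [hfp, hAp, hBp]; simp [D4.pd_zero]; rw [h2]
    linear_combination (-2) * h1
  · rw [hfp, hBp, hbp]; simp [D4.pd_zero]; ring

theorem D4.quad (a b c : ℂ) : ∃ x y : ℂ, (x ≠ 0 ∨ y ≠ 0) ∧ a * x ^ 2 + b * x * y + c * y ^ 2 = 0 := by
  by_cases ha : a = 0
  · exact ⟨1, 0, by simp, by simp [ha]⟩
  · obtain ⟨s, hs⟩ := IsAlgClosed.exists_pow_nat_eq (b ^ 2 - 4 * a * c) (n := 2) (by norm_num)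
    refine ⟨(-b + s) / (2 * a), 1, by simp, ?_⟩
    field_simp
    linear_combination hs

theorem D4.ker (p q r : ℂ) (h : p * r - q ^ 2 = 0) :
    ∃ x y : ℂ, (x ≠ 0 ∨ y ≠ 0) ∧ p * x + q * y = 0 ∧ q * x + r * y = 0 := by
  by_cases hp : p = 0
  · have hq : q = 0 := by simpa [hp] using h
    exact ⟨1, 0, by simp, by simp [hp], by simp [hq]⟩
  · exact ⟨-q, p, Or.inr hp, by ring, by linear_combination h⟩

theorem D4.canon (A B C D : ℂ)
    (hcubic : ∀ x y : ℂ, (x ≠ 0 ∨ y ≠ 0) →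
      ¬(A * x ^ 2 + 2 * B * x * y + C * y ^ 2 = 0 ∧ B * x ^ 2 + 2 * C * x * y + D * y ^ 2 = 0)) :
    ∃ α β γ δ : ℂ, α * δ - β * γ ≠ 0 ∧ 6 * (α ^ 3 + γ ^ 3) = A ∧
      6 * (α ^ 2 * β + γ ^ 2 * δ) = B ∧ 6 * (α * β ^ 2 + γ * δ ^ 2) = C ∧
      6 * (β ^ 3 + δ ^ 3) = D := by
  obtain ⟨w1, w2, hw, hH⟩ := D4.quad (A * C - B ^ 2) (A * D - B * C) (B * D - C ^ 2)
  obtain ⟨n1, n2, hn, E1, E2⟩ := D4.ker (A * w1 + B * w2) (B * w1 + C * w2) (C * w1 + D * w2)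
    (by linear_combination hH)
  have hΔ : w1 * n2 - w2 * n1 ≠ 0 := by
    intro h0
    apply hcubic w1 w2 hw
    rcases hn with h | h
    · constructor
      · refine (mul_eq_zero.1 (?_ : n1 * _ = 0)).resolve_left h
        linear_combination w1 * E1 - (B * w1 + C * w2) * h0
      · refine (mul_eq_zero.1 (?_ : n1 * _ = 0)).resolve_left h
        linear_combination w1 * E2 - (C * w1 + D * w2) * h0
    · constructor
      · refine (mul_eq_zero.1 (?_ : n2 * _ = 0)).resolve_left h
        linear_combination w2 * E1 + (A * w1 + B * w2) * h0
      · refine (mul_eq_zero.1 (?_ : n2 * _ = 0)).resolve_left h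
        linear_combination w2 * E2 + (B * w1 + C * w2) * h0
  -- nonvanishing on the two null directions
  have key : ∀ x y u v : ℂ, (x ≠ 0 ∨ y ≠ 0) → x * v - y * u ≠ 0 →
      (A * x + B * y) * u + (B * x + C * y) * v = 0 →
      (B * x + C * y) * u + (C * x + D * y) * v = 0 →
      A * x ^ 3 + 3 * B * x ^ 2 * y + 3 * C * x * y ^ 2 + D * y ^ 3 ≠ 0 := by
    intro x y u v hxy hd F1 F2 h0
    apply hcubic x y hxy
    constructor
    · refine (mul_eq_zero.1 (?_ : (x * v - y * u) * _ = 0)).resolve_left hd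
      linear_combination v * h0 - y * x * F1 - y * y * F2
    · refine (mul_eq_zero.1 (?_ : (x * v - y * u) * _ = 0)).resolve_left hd
      linear_combination (-u) * h0 + x * x * F1 + x * y * F2
  have hP := key w1 w2 n1 n2 hw hΔ E1 E2
  have hQ := key n1 n2 w1 w2 hn (by intro h; apply hΔ; linear_combination -h)
    (by linear_combination E1) (by linear_combination E2)
  obtain ⟨p, hp⟩ := IsAlgClosed.exists_pow_nat_eq
    ((A * w1 ^ 3 + 3 * B * w1 ^ 2 * w2 + 3 * C * w1 * w2 ^ 2 + D * w2 ^ 3) / 6) (n := 3)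
    (by norm_num)
  obtain ⟨q, hq⟩ := IsAlgClosed.exists_pow_nat_eq
    ((A * n1 ^ 3 + 3 * B * n1 ^ 2 * n2 + 3 * C * n1 * n2 ^ 2 + D * n2 ^ 3) / 6) (n := 3)
    (by norm_num)
  have hp0 : p ≠ 0 := by
    rintro rfl; apply hP; linear_combination (-6) * hp
  have hq0 : q ≠ 0 := by
    rintro rfl; apply hQ; linear_combination (-6) * hq
  have W := sub_eq_zero.2 hp
  have N := sub_eq_zero.2 hq
  generalize hd : w1 * n2 - w2 * n1 = d at hΔ
  refine ⟨p * n2 / d, -(p * n1) / d, -(q * w2) / d, q * w1 / d, ?_, ?_, ?_, ?_, ?_⟩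
  · have : p * n2 / d * (q * w1 / d) - -(p * n1) / d * (-(q * w2) / d) = p * q / d := by
      field_simp
      linear_combination hd
    rw [this]
    exact div_ne_zero (mul_ne_zero hp0 hq0) hΔ
  · field_simp
    subst hd
    linear_combination 6 * n2 ^ 3 * hp - 6 * w2 ^ 3 * hq
      + 3 * n2 ^ 2 * w2 * (w1 * E1 + w2 * E2) - 3 * n2 * w2 ^ 2 * (n1 * E1 + n2 * E2)
  · field_simp
    subst hd
    linear_combination -6 * n2 ^ 2 * n1 * hp + 6 * w2 ^ 2 * w1 * hq
      - (n2 ^ 2 * w1 + 2 * n2 * w2 * n1) * (w1 * E1 + w2 * E2)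
      + (w2 ^ 2 * n1 + 2 * n2 * w2 * w1) * (n1 * E1 + n2 * E2)
  · field_simp
    subst hd
    linear_combination 6 * n2 * n1 ^ 2 * hp - 6 * w2 * w1 ^ 2 * hq
      + (n1 ^ 2 * w2 + 2 * n2 * n1 * w1) * (w1 * E1 + w2 * E2)
      - (w1 ^ 2 * n2 + 2 * w2 * w1 * n1) * (n1 * E1 + n2 * E2)
  · field_simp
    subst hd
    linear_combination -6 * n1 ^ 3 * hp + 6 * w1 ^ 3 * hq
      - 3 * n1 ^ 2 * w1 * (w1 * E1 + w2 * E2) + 3 * n1 * w1 ^ 2 * (n1 * E1 + n2 * E2)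

/-- coefficient map of `(αX+βY)³ + (γX+δY)³`, with arguments `((α, β), (γ, δ))` -/
noncomputable def D4.G (m : (ℂ × ℂ) × (ℂ × ℂ)) : (ℂ × ℂ) × (ℂ × ℂ) :=
  ((m.1.1 ^ 3 + m.2.1 ^ 3, 3 * (m.1.1 ^ 2 * m.1.2 + m.2.1 ^ 2 * m.2.2)),
   (3 * (m.1.1 * m.1.2 ^ 2 + m.2.1 * m.2.2 ^ 2), m.1.2 ^ 3 + m.2.2 ^ 3))

theorem D4.G_inj {α β γ δ : ℂ} (h : α * δ - β * γ ≠ 0) {G' : (ℂ × ℂ) × (ℂ × ℂ) →L[ℂ] (ℂ × ℂ) × (ℂ × ℂ)}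
    (hG : HasFDerivAt D4.G G' ((α, β), (γ, δ))) (v : (ℂ × ℂ) × (ℂ × ℂ)) (hv : G' v = 0) : v = 0 := by
  obtain ⟨⟨a, b⟩, ⟨c, d⟩⟩ := v
  -- restrict to a line
  have hl : ∀ x y : ℂ, HasDerivAt (fun t : ℂ => x + t * y) y 0 := fun x y => by
    simpa using ((hasDerivAt_id (0 : ℂ)).mul_const y).const_add x
  have hline : HasDerivAt (fun t : ℂ => ((α + t * a, β + t * b), (γ + t * c, δ + t * d)))
      ((a, b), (c, d)) 0 := ((hl α a).prodMk (hl β b)).prodMk ((hl γ c).prodMk (hl δ d))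
  have hG0 : HasFDerivAt D4.G G'
      ((fun t : ℂ => ((α + t * a, β + t * b), (γ + t * c, δ + t * d))) 0) := by simpa using hG
  have h1 := hG0.comp_hasDerivAt (0 : ℂ) hline
  rw [hv] at h1
  have ha := hl α a
  have hb := hl β b
  have hc := hl γ c
  have hd := hl δ d
  have h2 := (((ha.pow 3).add (hc.pow 3)).prodMk
    ((((ha.pow 2).mul hb).add ((hc.pow 2).mul hd)).const_mul 3)).prodMk
    (((((ha.mul (hb.pow 2)).add (hc.mul (hd.pow 2))).const_mul 3)).prodMk
      ((hb.pow 3).add (hd.pow 3)))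
  have h3 := h1.unique h2
  simp [Prod.ext_iff] at h3
  obtain ⟨⟨e0, e1⟩, ⟨e2, e3⟩⟩ := h3
  have E0 : 3 * (α ^ 2 * a + γ ^ 2 * c) = 0 := by linear_combination -e0
  have E1 : 2 * α * β * a + α ^ 2 * b + 2 * γ * δ * c + γ ^ 2 * d = 0 := by linear_combination e1
  have E2 : 2 * α * β * b + β ^ 2 * a + 2 * γ * δ * d + δ ^ 2 * c = 0 := by linear_combination e2
  have E3 : 3 * (β ^ 2 * b + δ ^ 2 * d) = 0 := by linear_combination -e3
  have hD2 : (α * δ - β * γ) ^ 2 ≠ 0 := pow_ne_zero 2 h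
  have M0 : a * δ - b * γ = 0 := by
    refine (mul_eq_zero.1 (?_ : (α * δ - β * γ) ^ 2 * _ = 0)).resolve_left hD2
    linear_combination δ ^ 3 / 3 * E0 - δ ^ 2 * γ * E1 + δ * γ ^ 2 * E2 - γ ^ 3 / 3 * E3
  have N0 : c * β - d * α = 0 := by
    refine (mul_eq_zero.1 (?_ : (α * δ - β * γ) ^ 2 * _ = 0)).resolve_left hD2
    linear_combination β ^ 3 / 3 * E0 - β ^ 2 * α * E1 + β * α ^ 2 * E2 - α ^ 3 / 3 * E3
  have a0 : a = 0 := by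
    refine (mul_eq_zero.1 (?_ : (α * δ - β * γ) ^ 2 * _ = 0)).resolve_left hD2
    linear_combination δ ^ 2 * E0 - 2 * δ * γ * E1 + γ ^ 2 * E2 - 2 * (α * δ - β * γ) * α * M0
  have b0 : b = 0 := by
    refine (mul_eq_zero.1 (?_ : (α * δ - β * γ) ^ 2 * _ = 0)).resolve_left hD2
    linear_combination δ ^ 2 * E1 - 2 * δ * γ * E2 + γ ^ 2 * E3 - 2 * (α * δ - β * γ) * β * M0
  have c0 : c = 0 := by
    refine (mul_eq_zero.1 (?_ : (α * δ - β * γ) ^ 2 * _ = 0)).resolve_left hD2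
    linear_combination β ^ 2 * E0 - 2 * β * α * E1 + α ^ 2 * E2 + 2 * (α * δ - β * γ) * γ * N0
  have d0 : d = 0 := by
    refine (mul_eq_zero.1 (?_ : (α * δ - β * γ) ^ 2 * _ = 0)).resolve_left hD2
    linear_combination β ^ 2 * E1 - 2 * β * α * E2 + α ^ 2 * E3 + 2 * (α * δ - β * γ) * δ * N0
  simp [a0, b0, c0, d0]

theorem D4.G_analytic (m : (ℂ × ℂ) × (ℂ × ℂ)) : AnalyticAt ℂ D4.G m := by
  have p11 : AnalyticAt ℂ (fun m : (ℂ × ℂ) × (ℂ × ℂ) => m.1.1) m :=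
    analyticAt_fst.fun_comp analyticAt_fst
  have p12 : AnalyticAt ℂ (fun m : (ℂ × ℂ) × (ℂ × ℂ) => m.1.2) m :=
    analyticAt_snd.fun_comp analyticAt_fst
  have p21 : AnalyticAt ℂ (fun m : (ℂ × ℂ) × (ℂ × ℂ) => m.2.1) m :=
    analyticAt_fst.fun_comp analyticAt_snd
  have p22 : AnalyticAt ℂ (fun m : (ℂ × ℂ) × (ℂ × ℂ) => m.2.2) m :=
    analyticAt_snd.fun_comp analyticAt_snd
  exact (((p11.pow 3).add (p21.pow 3)).prod
    (analyticAt_const.mul (((p11.pow 2).mul p12).add ((p21.pow 2).mul p22)))).prod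
    ((analyticAt_const.mul ((p11.mul (p12.pow 2)).add (p21.mul (p22.pow 2)))).prod
      ((p12.pow 3).add (p22.pow 3)))

theorem stmt_6 (U : Set (ℂ × ℂ)) (hU : IsOpen U) (h0U : (0 : ℂ × ℂ) ∈ U)
    (ρ : ℂ × ℂ → ℂ) (hρ : AnalyticOnNhd ℂ ρ U)
    (hlow : ∀ i j : ℕ, i + j ≤ 2 → pd i j ρ = 0)
    (hcubic : ∀ w : ℂ × ℂ, w ≠ 0 →
      ¬(pd 3 0 ρ * w.1 ^ 2 + 2 * pd 2 1 ρ * w.1 * w.2 + pd 1 2 ρ * w.2 ^ 2 = 0 ∧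
        pd 2 1 ρ * w.1 ^ 2 + 2 * pd 1 2 ρ * w.1 * w.2 + pd 0 3 ρ * w.2 ^ 2 = 0)) :
    ∃ (V : Set (ℂ × ℂ)) (φ : ℂ × ℂ → ℂ × ℂ),
      IsOpen V ∧ (0 : ℂ × ℂ) ∈ V ∧ AnalyticOnNhd ℂ φ V ∧ φ 0 = 0 ∧
      Set.InjOn φ V ∧ Set.MapsTo φ V U ∧
      ∀ p ∈ V, ρ (φ p) = p.1 ^ 3 + p.2 ^ 3 := by
  obtain ⟨a, b, c, d, ha, hb, hc, hd, hexp, h30, h21, h12, h03⟩ := D4.decomp (hρ 0 h0U) hlow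
  obtain ⟨α, β, γ, δ, hΔ, e1, e2, e3, e4⟩ := D4.canon (pd 3 0 ρ) (pd 2 1 ρ) (pd 1 2 ρ) (pd 0 3 ρ)
    (fun x y hxy => hcubic (x, y) (by
      intro h
      simp only [Prod.mk_eq_zero] at h
      rcases hxy with h' | h'
      · exact h' h.1
      · exact h' h.2))
  have hK : AnalyticAt ℂ (fun z => ((a z, b z), (c z, d z))) 0 := (ha.prod hb).prod (hc.prod hd)
  have hK0 : D4.G ((α, β), (γ, δ)) = ((a 0, b 0), (c 0, d 0)) := by
    simp only [D4.G, Prod.mk.injEq]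
    refine ⟨⟨?_, ?_⟩, ?_, ?_⟩
    · linear_combination (e1 + h30) / 6
    · linear_combination (e2 + h21) / 2
    · linear_combination (e3 + h12) / 2
    · linear_combination (e4 + h03) / 6
  have hGd := (D4.G_analytic ((α, β), (γ, δ))).differentiableAt.hasFDerivAt
  obtain ⟨g, hg, hg0, hGg⟩ := D4.inv (D4.G_analytic _) hGd (D4.G_inj hΔ hGd)
  rw [hK0] at hg hg0 hGg
  have hM : AnalyticAt ℂ (fun z => g ((a z, b z), (c z, d z))) 0 :=
    AnalyticAt.fun_comp (g := g) (f := fun z => ((a z, b z), (c z, d z))) hg hK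
  have hMK : ∀ᶠ z in 𝓝 (0 : ℂ × ℂ), D4.G (g ((a z, b z), (c z, d z))) = ((a z, b z), (c z, d z)) :=
    (hK.continuousAt.tendsto).eventually hGg
  generalize hMd : (fun z => g ((a z, b z), (c z, d z))) = M at hM
  have hMz : ∀ z, g ((a z, b z), (c z, d z)) = M z := fun z => congrFun hMd z
  simp only [hMz] at hMK hg0
  have m11 : AnalyticAt ℂ (fun z => (M z).1.1) 0 := analyticAt_fst.fun_comp (analyticAt_fst.fun_comp hM)
  have m12 : AnalyticAt ℂ (fun z => (M z).1.2) 0 := analyticAt_snd.fun_comp (analyticAt_fst.fun_comp hM)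
  have m21 : AnalyticAt ℂ (fun z => (M z).2.1) 0 := analyticAt_fst.fun_comp (analyticAt_snd.fun_comp hM)
  have m22 : AnalyticAt ℂ (fun z => (M z).2.2) 0 := analyticAt_snd.fun_comp (analyticAt_snd.fun_comp hM)
  let ψ : ℂ × ℂ → ℂ × ℂ := fun z =>
    ((M z).1.1 * z.1 + (M z).1.2 * z.2, (M z).2.1 * z.1 + (M z).2.2 * z.2)
  have hψ : AnalyticAt ℂ ψ 0 :=
    ((m11.mul analyticAt_fst).add (m12.mul analyticAt_snd)).prod
      ((m21.mul analyticAt_fst).add (m22.mul analyticAt_snd))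
  have hψ0 : ψ 0 = 0 := by simp [ψ]
  have hψd := hψ.differentiableAt.hasFDerivAt
  have hψinj : ∀ v, fderiv ℂ ψ 0 v = 0 → v = 0 := by
    rintro ⟨x, y⟩ hv
    have hline : HasDerivAt (fun t : ℂ => (t * x, t * y)) (x, y) 0 := by
      have h1 : ∀ x : ℂ, HasDerivAt (fun t : ℂ => t * x) x 0 := fun x => by
        simpa using (hasDerivAt_id (0 : ℂ)).mul_const x
      exact (h1 x).prodMk (h1 y)
    have hz : ((0 : ℂ) * x, (0 : ℂ) * y) = 0 := by simp
    have h1 : HasDerivAt (ψ ∘ fun t : ℂ => (t * x, t * y)) (fderiv ℂ ψ 0 (x, y)) 0 := by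
      refine HasFDerivAt.comp_hasDerivAt (0 : ℂ) ?_ hline
      rw [hz]; exact hψd
    rw [hv] at h1
    have hN : DifferentiableAt ℂ (fun t : ℂ => M (t * x, t * y)) 0 := by
      refine DifferentiableAt.comp (0 : ℂ) (g := M) ?_ hline.differentiableAt
      rw [hz]; exact hM.differentiableAt
    have key : ∀ s : ℂ → ℂ, DifferentiableAt ℂ s 0 → HasDerivAt (fun t => t * s t) (s 0) 0 := by
      intro s hs
      have h := (hasDerivAt_id (0 : ℂ)).mul hs.hasDerivAt
      simp only [id, one_mul, zero_mul, add_zero] at h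
      exact h
    have h2 := (key (fun t => (M (t * x, t * y)).1.1 * x + (M (t * x, t * y)).1.2 * y)
      ((hN.fst.fst.mul_const x).add (hN.fst.snd.mul_const y))).prodMk
      (key (fun t => (M (t * x, t * y)).2.1 * x + (M (t * x, t * y)).2.2 * y)
      ((hN.snd.fst.mul_const x).add (hN.snd.snd.mul_const y)))
    have h3 : (ψ ∘ fun t : ℂ => (t * x, t * y)) = fun t => 
        (t * ((M (t * x, t * y)).1.1 * x + (M (t * x, t * y)).1.2 * y),
         t * ((M (t * x, t * y)).2.1 * x + (M (t * x, t * y)).2.2 * y)) := by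
      funext t
      simp only [ψ, Function.comp, Prod.mk.injEq]
      constructor <;> ring
    rw [h3] at h1
    have h4 := h1.unique h2
    have hM00 : M (0 * x, 0 * y) = ((α, β), (γ, δ)) := by
      rw [hz, hg0]
    simp only [hM00] at h4
    have h5 : α * x + β * y = 0 := (congrArg Prod.fst h4).symm
    have h6 : γ * x + δ * y = 0 := (congrArg Prod.snd h4).symm
    have hx : x = 0 := by
      refine (mul_eq_zero.1 (?_ : (α * δ - β * γ) * _ = 0)).resolve_left hΔ
      linear_combination δ * h5 - β * h6
    have hy : y = 0 := by
      refine (mul_eq_zero.1 (?_ : (α * δ - β * γ) * _ = 0)).resolve_left hΔ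
      linear_combination α * h6 - γ * h5
    simp [hx, hy]
  obtain ⟨φ, hφ, hφ0, hψφ⟩ := D4.inv hψ hψd hψinj
  rw [hψ0] at hφ hφ0 hψφ
  have htend : Tendsto φ (𝓝 0) (𝓝 0) := by
    have := hφ.continuousAt.tendsto
    rwa [hφ0] at this
  have hall := hφ.eventually_analyticAt.and (hψφ.and ((htend.eventually (hU.mem_nhds h0U)).and
    ((htend.eventually hexp).and (htend.eventually hMK))))
  obtain ⟨V, hV, hVo, hV0⟩ := eventually_nhds_iff.1 hall
  refine ⟨V, φ, hVo, hV0, fun p hp => (hV p hp).1, hφ0, ?_, fun p hp => (hV p hp).2.2.1, ?_⟩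
  · intro p hp q hq hpq
    rw [← (hV p hp).2.1, ← (hV q hq).2.1, hpq]
  · intro p hp
    obtain ⟨-, h1, -, h2, h3⟩ := hV p hp
    rw [h2]
    conv_rhs => rw [← h1]
    simp only [D4.G, Prod.ext_iff] at h3
    obtain ⟨⟨k1, k2⟩, k3, k4⟩ := h3
    simp only [ψ]
    rw [← k1, ← k2, ← k3, ← k4]
    ring
end

section
/- Let ρ be holomorphic near 0 in ℂ² with ρᵢⱼ = 0 for all i+j ≤ 2, and ρ₃₀ = ρ₂₁ = ρ₁₂ = ρ₄₀ = 0, while ρ₀₃ ≠ 0 and ρ₃₁ ≠ 0. Then there exists a holomorphic coordinate chart (u,v) centered at the origin with ρ(u,v) = v³ + u³v (E₇ normal form). -/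
open Filter Topology

namespace E7

/-- projection `(x, y) ↦ (x, 0)`. -/
noncomputable def P : ℂ × ℂ →L[ℂ] ℂ × ℂ := (ContinuousLinearMap.fst ℂ ℂ ℂ).prod 0

lemma P_apply (z : ℂ × ℂ) : P z = (z.1, 0) := rfl

lemma norm_P_le : ‖P‖ ≤ 1 := by
  refine ContinuousLinearMap.opNorm_le_bound _ zero_le_one fun z => ?_
  simp [P_apply, Prod.norm_def]

/-- the choice of substitutions -/
noncomputable def S (n : ℕ) (k : Fin (n + 1)) (i : Fin n) : ℂ × ℂ →L[ℂ] ℂ × ℂ :=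
  if i.castSucc < k then ContinuousLinearMap.id ℂ _ else P

lemma norm_S_le (n : ℕ) (k : Fin (n + 1)) (i : Fin n) : ‖S n k i‖ ≤ 1 := by
  unfold S
  split_ifs
  · exact ContinuousLinearMap.norm_id_le
  · exact norm_P_le

/-- quotient series -/
noncomputable def qs (p : FormalMultilinearSeries ℂ (ℂ × ℂ) ℂ) :
    FormalMultilinearSeries ℂ (ℂ × ℂ) ℂ := fun n =>
  ∑ k : Fin (n + 1), ContinuousMultilinearMap.compContinuousLinearMap
    ((p (n + 1)).curryMid k ((0 : ℂ), (1 : ℂ))) (S n k)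

lemma norm_qs_le (p : FormalMultilinearSeries ℂ (ℂ × ℂ) ℂ) (n : ℕ) :
    ‖qs p n‖ ≤ (n + 1) * ‖p (n + 1)‖ := by
  unfold qs
  refine (norm_sum_le _ _).trans ?_
  have : ∀ k ∈ (Finset.univ : Finset (Fin (n + 1))),
      ‖ContinuousMultilinearMap.compContinuousLinearMap
        ((p (n + 1)).curryMid k ((0 : ℂ), (1 : ℂ))) (S n k)‖ ≤ ‖p (n + 1)‖ := by
    intro k _
    refine (ContinuousMultilinearMap.norm_compContinuousLinearMap_le _ _).trans ?_
    have h1 : ∏ i, ‖S n k i‖ ≤ 1 := Finset.prod_le_one (fun i _ => norm_nonneg _)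
      (fun i _ => norm_S_le n k i)
    have h2 : ‖(p (n + 1)).curryMid k ((0 : ℂ), (1 : ℂ))‖ ≤ ‖p (n + 1)‖ := by
      refine (ContinuousLinearMap.le_opNorm _ _).trans ?_
      rw [ContinuousMultilinearMap.norm_curryMid]
      simp [Prod.norm_def]
    calc _ ≤ ‖p (n + 1)‖ * 1 := by gcongr
      _ = _ := mul_one _
  refine (Finset.sum_le_sum this).trans ?_
  simp

lemma qs_apply (p : FormalMultilinearSeries ℂ (ℂ × ℂ) ℂ) (n : ℕ) (z : ℂ × ℂ) :
    z.2 * qs p n (fun _ => z) = p (n + 1) (fun _ => z) - p (n + 1) (fun _ => P z) := by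
  let T : ℕ → ℂ := fun k => p (n + 1) (fun i => if i.val < k then z else P z)
  have hT : p (n + 1) (fun _ => z) - p (n + 1) (fun _ => P z) = T (n + 1) - T 0 := by
    simp only [T]
    congr 3
    funext i
    simp [i.2]
  rw [hT, ← Finset.sum_range_sub, Finset.sum_range]
  unfold qs
  rw [sum_apply, Finset.mul_sum]
  refine Finset.sum_congr rfl fun k _ => ?_
  rw [ContinuousMultilinearMap.compContinuousLinearMap_apply]
  have e1 : T (k + 1) = (p (n + 1)).curryMid k z (fun i => S n k i z) := by
    rw [ContinuousMultilinearMap.curryMid_apply]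
    simp only [T]
    congr 1
    funext i
    refine Fin.succAboveCases k ?_ (fun j => ?_) i
    · simp
    · simp only [Fin.insertNth_apply_succAbove, S]
      by_cases h : j.castSucc < k
      · have := h
        rw [Fin.succAbove_of_castSucc_lt _ _ h]
        have h' : j.val < k.val := h
        simp [h, Nat.lt_succ_of_lt h']
      · rw [Fin.succAbove_of_le_castSucc _ _ (not_lt.mp h)]
        have h' : ¬ j.val < k.val := h
        simp [h, h']
  have e2 : T k = (p (n + 1)).curryMid k (P z) (fun i => S n k i z) := by
    rw [ContinuousMultilinearMap.curryMid_apply]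
    simp only [T]
    congr 1
    funext i
    refine Fin.succAboveCases k ?_ (fun j => ?_) i
    · simp
    · simp only [Fin.insertNth_apply_succAbove, S]
      by_cases h : j.castSucc < k
      · rw [Fin.succAbove_of_castSucc_lt _ _ h]
        have h' : j.val < k.val := h
        simp [h, h']
      · rw [Fin.succAbove_of_le_castSucc _ _ (not_lt.mp h)]
        have h' : ¬ j.val < k.val := h
        have h'' : ¬ (j.val + 1) < k.val := by omega
        simp [h, h'']
  rw [e1, e2, ← sub_apply, ← map_sub]
  have : z - P z = z.2 • ((0 : ℂ), (1 : ℂ)) := by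
    ext <;> simp [P_apply]
  rw [this, map_smul, smul_apply, smul_eq_mul]

/-- Hadamard division. -/
lemma division {g : ℂ × ℂ → ℂ} (hg : AnalyticAt ℂ g 0) :
    ∃ g1 : ℂ × ℂ → ℂ, AnalyticAt ℂ g1 0 ∧ ∀ᶠ z in 𝓝 (0 : ℂ × ℂ), g z = g (z.1, 0) + z.2 * g1 z := by
  obtain ⟨p, R, hp⟩ := hg
  obtain ⟨r, hr0, hrR⟩ := ENNReal.lt_iff_exists_nnreal_btwn.mp hp.r_pos
  have hr0' : 0 < r := by exact_mod_cast hr0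
  obtain ⟨C, hC, hb⟩ := p.norm_mul_pow_le_of_lt_radius (hrR.trans_le hp.r_le)
  have hrad : ((r / 2 : NNReal) : ENNReal) ≤ (qs p).radius := by
    refine FormalMultilinearSeries.le_radius_of_bound _ (C / r) fun n => ?_
    have hn : ((n : ℝ) + 1) ≤ 2 ^ n := by exact_mod_cast Nat.lt_two_pow_self (n := n)
    have hrr : (0 : ℝ) < r := hr0'
    rw [le_div_iff₀ hrr]
    calc ‖qs p n‖ * ((r / 2 : NNReal) : ℝ) ^ n * r
        ≤ (2 ^ n * ‖p (n + 1)‖) * ((r / 2 : NNReal) : ℝ) ^ n * r := by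
          gcongr
          exact (norm_qs_le p n).trans (by gcongr)
      _ = ‖p (n + 1)‖ * r ^ (n + 1) := by
          push_cast
          rw [div_pow]
          field_simp
          ring
      _ ≤ C := hb _
  have hpos : 0 < (qs p).radius := lt_of_lt_of_le (by simpa using hr0'.ne') hrad
  have hq := (qs p).hasFPowerSeriesOnBall hpos
  refine ⟨(qs p).sum, hq.analyticAt, ?_⟩
  have hm1 : ∀ᶠ z in 𝓝 (0 : ℂ × ℂ), z ∈ Metric.eball (0 : ℂ × ℂ) R := Metric.eball_mem_nhds _ hp.r_pos
  have hm2 : ∀ᶠ z in 𝓝 (0 : ℂ × ℂ), z ∈ Metric.eball (0 : ℂ × ℂ) (qs p).radius :=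
    Metric.eball_mem_nhds _ hpos
  have hPc : Tendsto P (𝓝 0) (𝓝 0) := by simpa using P.continuous.tendsto 0
  filter_upwards [hm1, hm2, hPc.eventually hm1] with z h1 h2 h3
  have s1 := hp.hasSum h1
  have s2 := hp.hasSum h3
  have s3 := (hq.hasSum h2).mul_left z.2
  simp only [zero_add] at s1 s2 s3
  have s4 := s1.sub s2
  rw [← hasSum_nat_add_iff' 1] at s4
  simp only [qs_apply] at s3
  have := s3.unique s4
  rw [this, P_apply]
  have h00 : p 0 (fun _ => z) = p 0 (fun _ => ((z.1, 0) : ℂ × ℂ)) := by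
    congr 1; funext i; exact i.elim0
  simp [h00]


@[fun_prop]
lemma analyticAt_fst' (z : ℂ × ℂ) : AnalyticAt ℂ (fun z : ℂ × ℂ => z.1) z := analyticAt_fst

@[fun_prop]
lemma analyticAt_snd' (z : ℂ × ℂ) : AnalyticAt ℂ (fun z : ℂ × ℂ => z.2) z := analyticAt_snd

lemma iteratedDeriv_id_mul {k : ℂ → ℂ} (hk : AnalyticAt ℂ k 0) (c : ℂ) (j : ℕ) :
    iteratedDeriv (j + 1) (fun y => c + y * k y) 0 = (j + 1) * iteratedDeriv j k 0 := by
  rw [iteratedDeriv_const_add (by omega) c, iteratedDeriv_fun_mul contDiffAt_fun_id hk.contDiffAt]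
  rw [Finset.sum_eq_single 1]
  · simp [iteratedDeriv_fun_id_zero]
  · intro i _ hi
    simp [iteratedDeriv_fun_id_zero, hi]
  · simp

lemma pd_succ {ρ ρ1 : ℂ × ℂ → ℂ} (h1 : AnalyticAt ℂ ρ1 0)
    (h : ∀ᶠ z in 𝓝 (0 : ℂ × ℂ), ρ z = ρ (z.1, 0) + z.2 * ρ1 z) (i j : ℕ) :
    pd i (j + 1) ρ = (j + 1) * pd i j ρ1 := by
  have hc : Tendsto (fun x : ℂ => (x, (0 : ℂ))) (𝓝 0) (𝓝 0) := by
    have : Continuous (fun x : ℂ => (x, (0 : ℂ))) := by fun_prop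
    exact this.tendsto 0
  unfold pd
  rw [← iteratedDeriv_const_mul_field]
  refine Filter.EventuallyEq.iteratedDeriv_eq i ?_
  filter_upwards [hc.eventually h.eventually_nhds, hc.eventually h1.eventually_analyticAt] with x hx hx1
  have hcy : Tendsto (fun y : ℂ => (x, y)) (𝓝 0) (𝓝 (x, 0)) := by
    have : Continuous (fun y : ℂ => (x, y)) := by fun_prop
    exact this.tendsto 0
  have hk : AnalyticAt ℂ (fun y => ρ1 (x, y)) 0 :=
    AnalyticAt.fun_comp_of_eq (f := fun y : ℂ => (x, y)) hx1 (by fun_prop) rfl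
  rw [← iteratedDeriv_id_mul hk (ρ (x, 0))]
  refine Filter.EventuallyEq.iteratedDeriv_eq _ ?_
  filter_upwards [hcy.eventually hx] with y hy
  exact hy

lemma analyticAt_slice {g : ℂ × ℂ → ℂ} (hg : AnalyticAt ℂ g 0) :
    AnalyticAt ℂ (fun x => g (x, 0)) 0 :=
  AnalyticAt.fun_comp_of_eq (f := fun x : ℂ => (x, (0 : ℂ))) hg (by fun_prop) rfl

lemma pd_zero_right (g : ℂ × ℂ → ℂ) (i : ℕ) : pd i 0 g = iteratedDeriv i (fun x => g (x, 0)) 0 := by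
  simp [pd]

lemma prep {ρ : ℂ × ℂ → ℂ} (hρ : AnalyticAt ℂ ρ 0)
    (hlow : ∀ i j : ℕ, i + j ≤ 2 → pd i j ρ = 0)
    (h30 : pd 3 0 ρ = 0) (h21 : pd 2 1 ρ = 0) (h12 : pd 1 2 ρ = 0)
    (h40 : pd 4 0 ρ = 0) (h03 : pd 0 3 ρ ≠ 0) (h31 : pd 3 1 ρ ≠ 0) :
    ∃ (e a b : ℂ → ℂ) (G : ℂ × ℂ → ℂ), AnalyticAt ℂ e 0 ∧ AnalyticAt ℂ a 0 ∧ AnalyticAt ℂ b 0 ∧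
      AnalyticAt ℂ G 0 ∧ a 0 ≠ 0 ∧ G 0 ≠ 0 ∧ ∀ᶠ z in 𝓝 (0 : ℂ × ℂ),
        ρ z = z.1 ^ 5 * e z.1 + z.1 ^ 3 * a z.1 * z.2 + z.1 ^ 2 * b z.1 * z.2 ^ 2 + z.2 ^ 3 * G z := by
  obtain ⟨ρ1, hρ1, e1⟩ := division hρ
  obtain ⟨ρ2, hρ2, e2⟩ := division hρ1
  obtain ⟨ρ3, hρ3, e3⟩ := division hρ2
  have p1 : ∀ i, pd i 1 ρ = iteratedDeriv i (fun x => ρ1 (x, 0)) 0 := fun i => by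
    have := pd_succ hρ1 e1 i 0
    simpa [pd_zero_right] using this
  have p2 : ∀ i, pd i 2 ρ = 2 * iteratedDeriv i (fun x => ρ2 (x, 0)) 0 := fun i => by
    rw [pd_succ hρ1 e1 i 1, pd_succ hρ2 e2 i 0, pd_zero_right]
    push_cast; ring
  have p3 : pd 0 3 ρ = 6 * ρ3 0 := by
    rw [pd_succ hρ1 e1 0 2, pd_succ hρ2 e2 0 1, pd_succ hρ3 e3 0 0, pd_zero_right]
    simp only [iteratedDeriv_zero, Prod.mk_zero_zero]
    push_cast; ring
  have f0 : ((5 : ℕ) : ℕ∞) ≤ analyticOrderAt (fun x => ρ (x, 0)) 0 := by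
    rw [natCast_le_analyticOrderAt_iff_iteratedDeriv_eq_zero (analyticAt_slice hρ)]
    intro i hi
    rw [← pd_zero_right]
    interval_cases i
    · exact hlow 0 0 (by norm_num)
    · exact hlow 1 0 (by norm_num)
    · exact hlow 2 0 (by norm_num)
    · exact h30
    · exact h40
  have f1 : analyticOrderAt (fun x => ρ1 (x, 0)) 0 = ((3 : ℕ) : ℕ∞) := by
    rw [analyticOrderAt_eq_nat_iff_iteratedDeriv_eq_zero (analyticAt_slice hρ1)]
    refine ⟨?_, ?_⟩
    · intro i hi
      rw [← p1]
      interval_cases i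
      · exact hlow 0 1 (by norm_num)
      · exact hlow 1 1 (by norm_num)
      · exact h21
    · rw [← p1]; exact h31
  have f2 : ((2 : ℕ) : ℕ∞) ≤ analyticOrderAt (fun x => ρ2 (x, 0)) 0 := by
    rw [natCast_le_analyticOrderAt_iff_iteratedDeriv_eq_zero (analyticAt_slice hρ2)]
    intro i hi
    have : pd i 2 ρ = 0 := by
      interval_cases i
      · exact hlow 0 2 (by norm_num)
      · exact h12
    rw [p2] at this
    simpa using this
  obtain ⟨e, he, he'⟩ := (natCast_le_analyticOrderAt (analyticAt_slice hρ)).mp f0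
  obtain ⟨a, ha, ha0, ha'⟩ := ((analyticAt_slice hρ1).analyticOrderAt_eq_natCast).mp f1
  obtain ⟨b, hb, hb'⟩ := (natCast_le_analyticOrderAt (analyticAt_slice hρ2)).mp f2
  refine ⟨e, a, b, ρ3, he, ha, hb, hρ3, ha0, ?_, ?_⟩
  · intro h
    exact h03 (by rw [p3, h, mul_zero])
  · have hfst : Tendsto (Prod.fst : ℂ × ℂ → ℂ) (𝓝 0) (𝓝 0) := continuous_fst.tendsto 0
    filter_upwards [e1, e2, e3, hfst.eventually he', hfst.eventually ha', hfst.eventually hb']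
      with z h1 h2 h3 h4 h5 h6
    rw [h1, h2, h3, h4, h5, h6]
    simp only [smul_eq_mul, sub_zero]
    ring

lemma cube_root {p : ℂ × ℂ → ℂ} (hp : AnalyticAt ℂ p 0) (h0 : p 0 ≠ 0) :
    ∃ q : ℂ × ℂ → ℂ, AnalyticAt ℂ q 0 ∧ q 0 ≠ 0 ∧ ∀ z, q z ^ 3 = p z := by
  obtain ⟨c, hc⟩ := IsAlgClosed.exists_pow_nat_eq (p 0) (n := 3) (by norm_num)
  have hc0 : c ≠ 0 := by
    rintro rfl
    exact h0 (by rw [← hc]; norm_num)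
  have key : ∀ z, (c * (p z / p 0) ^ ((1 : ℂ) / 3)) ^ 3 = p z := by
    intro z
    rw [mul_pow, hc, ← Complex.cpow_nat_mul]
    norm_num
    field_simp
  refine ⟨fun z => c * (p z / p 0) ^ ((1 : ℂ) / 3), ?_, ?_, key⟩
  · refine analyticAt_const.mul (AnalyticAt.cpow (hp.div analyticAt_const h0) analyticAt_const ?_)
    simp [h0]
  · intro h
    have := key 0
    simp only at h
    rw [h] at this
    exact h0 (by rw [← this]; norm_num)

lemma inverse {Ψ : ℂ × ℂ → ℂ × ℂ} {p : ℂ × ℂ} (h : AnalyticAt ℂ Ψ p)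
    {L : ℂ × ℂ →L[ℂ] ℂ × ℂ} (hL : HasFDerivAt Ψ L p) (hinj : ∀ v, L v = 0 → v = 0) :
    ∃ ψ : ℂ × ℂ → ℂ × ℂ, AnalyticAt ℂ ψ (Ψ p) ∧ ψ (Ψ p) = p ∧ ∀ᶠ z in 𝓝 (Ψ p), Ψ (ψ z) = z := by
  have hi : Function.Injective (L : ℂ × ℂ →ₗ[ℂ] ℂ × ℂ) := by
    rw [injective_iff_map_eq_zero]
    exact hinj
  let L' : (ℂ × ℂ) ≃L[ℂ] (ℂ × ℂ) :=
    (LinearEquiv.ofInjectiveEndo (L : ℂ × ℂ →ₗ[ℂ] ℂ × ℂ) hi).toContinuousLinearEquiv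
  have hL' : (L' : ℂ × ℂ →L[ℂ] ℂ × ℂ) = L := by
    ext <;> rfl
  rw [← hL'] at hL
  have hc : ContDiffAt ℂ ⊤ Ψ p := h.contDiffAt
  refine ⟨hc.localInverse hL (by simp), ?_, hc.localInverse_apply_image hL _, ?_⟩
  · exact (hc.to_localInverse hL (by simp)).analyticAt
  · exact (hc.hasStrictFDerivAt' hL (by simp)).eventually_right_inverse

lemma implicit {Φ : ℂ × ℂ → ℂ} {w0 d : ℂ} (h : AnalyticAt ℂ Φ (0, w0)) (h0 : Φ (0, w0) = 0)
    (hd : HasDerivAt (fun w => Φ (0, w)) d w0) (hd0 : d ≠ 0) :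
    ∃ w : ℂ → ℂ, AnalyticAt ℂ w 0 ∧ w 0 = w0 ∧ ∀ᶠ x in 𝓝 (0 : ℂ), Φ (x, w x) = 0 := by
  obtain ⟨D, hD⟩ : ∃ D, HasFDerivAt Φ D (0, w0) := ⟨_, h.differentiableAt.hasFDerivAt⟩
  have hDd : D (0, 1) = d := by
    have hl : HasDerivAt (fun w : ℂ => ((0 : ℂ), w)) (0, 1) w0 :=
      (hasDerivAt_const w0 (0 : ℂ)).prodMk (hasDerivAt_id w0)
    exact (hD.comp_hasDerivAt w0 hl).unique hd
  have hΨ : AnalyticAt ℂ (fun z : ℂ × ℂ => (z.1, Φ z)) (0, w0) := analyticAt_fst.prod h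
  have hL : HasFDerivAt (fun z : ℂ × ℂ => (z.1, Φ z)) ((ContinuousLinearMap.fst ℂ ℂ ℂ).prod D) (0, w0) :=
    hasFDerivAt_fst.prodMk hD
  obtain ⟨ψ, hψ, hψ0, hψe⟩ := inverse hΨ hL (by
    rintro ⟨x, y⟩ hv
    simp only [ContinuousLinearMap.prod_apply, ContinuousLinearMap.coe_fst', Prod.mk_eq_zero] at hv
    obtain ⟨rfl, hv⟩ := hv
    have : ((0 : ℂ), y) = y • ((0 : ℂ), (1 : ℂ)) := by simp
    rw [this, map_smul, hDd, smul_eq_mul] at hv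
    simpa [hd0] using hv)
  simp only [h0] at hψ hψ0 hψe
  refine ⟨fun x => (ψ (x, 0)).2, ?_, by simp [hψ0], ?_⟩
  · refine AnalyticAt.fun_comp (g := Prod.snd) analyticAt_snd ?_
    exact AnalyticAt.fun_comp_of_eq (f := fun x : ℂ => (x, (0 : ℂ))) hψ (by fun_prop) rfl
  · have hc : Tendsto (fun x : ℂ => (x, (0 : ℂ))) (𝓝 0) (𝓝 (0, 0)) := by
      have : Continuous (fun x : ℂ => (x, (0 : ℂ))) := by fun_prop
      exact this.tendsto 0
    filter_upwards [hc.eventually hψe] with x hx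
    simp only [Prod.mk.injEq] at hx
    obtain ⟨hx1, hx2⟩ := hx
    have : (x, (ψ (x, 0)).2) = ψ (x, 0) := Prod.ext hx1.symm rfl
    rw [this, hx2]

lemma normal {a b C : ℂ × ℂ → ℂ} (ha : AnalyticAt ℂ a 0) (hb : AnalyticAt ℂ b 0)
    (hC : AnalyticAt ℂ C 0) (ha0 : a 0 ≠ 0) (hC0 : C 0 ≠ 0) :
    ∃ Θ ψ : ℂ × ℂ → ℂ × ℂ, AnalyticAt ℂ ψ 0 ∧ ψ 0 = 0 ∧
      (∀ᶠ p in 𝓝 (0 : ℂ × ℂ), Θ (ψ p) = p) ∧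
      ∀ᶠ z in 𝓝 (0 : ℂ × ℂ),
        z.2 * (z.1 ^ 3 * a z + z.1 ^ 2 * b z * z.2 + C z * z.2 ^ 2) =
          (Θ z).2 ^ 3 + (Θ z).1 ^ 3 * (Θ z).2 := by
  have hC2 : AnalyticAt ℂ (fun z : ℂ × ℂ =>
      C z - z.1 * b z ^ 2 / (3 * a z) - z.2 * b z ^ 3 / (27 * a z ^ 2)) 0 := by
    refine (hC.sub (AnalyticAt.div (by fun_prop) (by fun_prop) ?_)).sub
      (AnalyticAt.div (by fun_prop) (by fun_prop) ?_) <;> simp [ha0]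
  obtain ⟨β, hβ, hβ0, hβe⟩ := cube_root hC2 (by simpa using hC0)
  obtain ⟨α, hα, hα0, hαe⟩ := cube_root (ha.div hβ hβ0) (by simp [ha0, hβ0])
  have hB : AnalyticAt ℂ (fun z => b z / (3 * a z) * α z) 0 :=
    (AnalyticAt.div hb (by fun_prop) (by simp [ha0])).mul hα
  have hu : HasFDerivAt (fun z : ℂ × ℂ => z.1 * α z + z.2 * (b z / (3 * a z) * α z))
      (α 0 • ContinuousLinearMap.fst ℂ ℂ ℂ + (b 0 / (3 * a 0) * α 0) • ContinuousLinearMap.snd ℂ ℂ ℂ)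
      0 := by
    have := ((hasFDerivAt_fst (𝕜 := ℂ) (E := ℂ) (F := ℂ) (p := 0)).mul hα.differentiableAt.hasFDerivAt).add
      ((hasFDerivAt_snd (𝕜 := ℂ) (E := ℂ) (F := ℂ) (p := 0)).mul hB.differentiableAt.hasFDerivAt)
    refine this.congr_fderiv ?_
    ext <;> simp
  have hv : HasFDerivAt (fun z : ℂ × ℂ => z.2 * β z) (β 0 • ContinuousLinearMap.snd ℂ ℂ ℂ) 0 := by
    have := (hasFDerivAt_snd (𝕜 := ℂ) (E := ℂ) (F := ℂ) (p := 0)).mul hβ.differentiableAt.hasFDerivAt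
    refine this.congr_fderiv ?_
    ext <;> simp
  have hΘ : AnalyticAt ℂ (fun z : ℂ × ℂ =>
      (z.1 * α z + z.2 * (b z / (3 * a z) * α z), z.2 * β z)) 0 := by
    exact ((analyticAt_fst.mul hα).add (analyticAt_snd.mul hB)).prod (analyticAt_snd.mul hβ)
  obtain ⟨ψ, h1, h2, h3⟩ := inverse hΘ (hu.prodMk hv) (by
    rintro ⟨x, y⟩ h
    simp [hβ0] at h
    obtain ⟨h, rfl⟩ := h
    simpa [hα0] using h)
  simp only [Prod.fst_zero, Prod.snd_zero, zero_mul, add_zero, Prod.mk_zero_zero] at h1 h2 h3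
  refine ⟨fun z : ℂ × ℂ =>
      (z.1 * α z + z.2 * (b z / (3 * a z) * α z), z.2 * β z), ψ, h1, h2, h3, ?_⟩
  filter_upwards [ha.continuousAt.eventually_ne ha0, hβ.continuousAt.eventually_ne hβ0] with z ha hβ
  have e1 := hβe z
  have e2 := hαe z
  simp only [Pi.div_apply] at e2
  have : (z.1 * α z + z.2 * (b z / (3 * a z) * α z)) ^ 3 * (z.2 * β z)
      = (z.1 + z.2 * (b z / (3 * a z))) ^ 3 * (α z ^ 3 * β z) * z.2 := by ring
  rw [this, e2, mul_pow, e1]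
  field_simp
  ring

lemma shift {e a b : ℂ → ℂ} {G : ℂ × ℂ → ℂ} (he : AnalyticAt ℂ e 0) (ha : AnalyticAt ℂ a 0)
    (hb : AnalyticAt ℂ b 0) (hG : AnalyticAt ℂ G 0) (ha0 : a 0 ≠ 0) :
    ∃ w : ℂ → ℂ, AnalyticAt ℂ w 0 ∧ ∀ᶠ x in 𝓝 (0 : ℂ),
      e x + a x * w x + x * (b x * w x ^ 2 + w x ^ 3 * G (x, x ^ 2 * w x)) = 0 := by
  have hG' : AnalyticAt ℂ (fun z : ℂ × ℂ => G (z.1, z.1 ^ 2 * z.2)) (0, -e 0 / a 0) :=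
    AnalyticAt.fun_comp_of_eq (f := fun z : ℂ × ℂ => (z.1, z.1 ^ 2 * z.2)) hG (by fun_prop) (by simp)
  have l : ∀ {f : ℂ → ℂ}, AnalyticAt ℂ f 0 → AnalyticAt ℂ (fun z : ℂ × ℂ => f z.1) (0, -e 0 / a 0) :=
    fun hf => AnalyticAt.fun_comp_of_eq (f := fun z : ℂ × ℂ => z.1) hf (by fun_prop) (by simp)
  have he' := l he
  have ha' := l ha
  have hb' := l hb
  obtain ⟨w, hw, -, hw'⟩ := implicit (Φ := fun z : ℂ × ℂ => e z.1 + a z.1 * z.2 +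
    z.1 * (b z.1 * z.2 ^ 2 + z.2 ^ 3 * G (z.1, z.1 ^ 2 * z.2))) (w0 := -e 0 / a 0) (d := a 0)
    ((he'.add (ha'.mul analyticAt_snd)).add (analyticAt_fst.mul
      ((hb'.mul (analyticAt_snd.pow 2)).add ((analyticAt_snd.pow 3).mul hG')))) (by simp; field_simp; ring) (by
      simp only [zero_mul, add_zero]
      simpa using ((hasDerivAt_id (-e 0 / a 0)).const_mul (a 0)).const_add (e 0)) ha0
  exact ⟨w, hw, hw'⟩

end E7

theorem stmt_11 (U : Set (ℂ × ℂ)) (hU : IsOpen U) (h0U : (0 : ℂ × ℂ) ∈ U)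
    (ρ : ℂ × ℂ → ℂ) (hρ : AnalyticOnNhd ℂ ρ U)
    (hlow : ∀ i j : ℕ, i + j ≤ 2 → pd i j ρ = 0)
    (h30 : pd 3 0 ρ = 0) (h21 : pd 2 1 ρ = 0) (h12 : pd 1 2 ρ = 0)
    (h40 : pd 4 0 ρ = 0) (h03 : pd 0 3 ρ ≠ 0) (h31 : pd 3 1 ρ ≠ 0) :
    ∃ (V : Set (ℂ × ℂ)) (φ : ℂ × ℂ → ℂ × ℂ),
      IsOpen V ∧ (0 : ℂ × ℂ) ∈ V ∧ AnalyticOnNhd ℂ φ V ∧ φ 0 = 0 ∧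
      Set.InjOn φ V ∧ Set.MapsTo φ V U ∧
      ∀ p ∈ V, ρ (φ p) = p.2 ^ 3 + p.1 ^ 3 * p.2 := by
  obtain ⟨e, a, b, G, he, ha, hb, hG, ha0, hG0, hρe⟩ :=
    E7.prep (hρ 0 h0U) hlow h30 h21 h12 h40 h03 h31
  obtain ⟨w, hw, hwe⟩ := E7.shift he ha hb hG ha0
  have l : ∀ {f : ℂ → ℂ}, AnalyticAt ℂ f 0 → AnalyticAt ℂ (fun z : ℂ × ℂ => f z.1) 0 :=
    fun hf => AnalyticAt.fun_comp_of_eq (f := fun z : ℂ × ℂ => z.1) hf (by fun_prop) (by simp)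
  have hw' := l hw
  have ha' := l ha
  have hb' := l hb
  have hσ : AnalyticAt ℂ (fun z : ℂ × ℂ => (z.1, z.2 + z.1 ^ 2 * w z.1)) 0 := by fun_prop
  have hH : AnalyticAt ℂ (fun z : ℂ × ℂ => G (z.1, z.2 + z.1 ^ 2 * w z.1)) 0 :=
    AnalyticAt.fun_comp_of_eq (f := fun z : ℂ × ℂ => (z.1, z.2 + z.1 ^ 2 * w z.1)) hG hσ (by simp)
  obtain ⟨H1, hH1, hH1e⟩ := E7.division hH
  obtain ⟨Θ, ψ, hψ, hψ0, hΘψ, hnorm⟩ := E7.normal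
    (a := fun z => a z.1 + 2 * z.1 * b z.1 * w z.1
      + 3 * z.1 * w z.1 ^ 2 * G (z.1, z.2 + z.1 ^ 2 * w z.1) + z.1 ^ 3 * w z.1 ^ 3 * H1 z)
    (b := fun z => b z.1 + 3 * w z.1 * G (z.1, z.2 + z.1 ^ 2 * w z.1))
    (C := fun z => G (z.1, z.2 + z.1 ^ 2 * w z.1))
    (((ha'.add (((analyticAt_const.mul analyticAt_fst).mul hb').mul hw')).add
      (((analyticAt_const.mul analyticAt_fst).mul (hw'.pow 2)).mul hH)).add
      (((analyticAt_fst.pow 3).mul (hw'.pow 3)).mul hH1))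
    (hb'.add ((analyticAt_const.mul hw').mul hH)) hH (by simpa using ha0) (by simpa [Prod.mk_zero_zero] using hG0)
  have hφ : AnalyticAt ℂ (fun p => ((ψ p).1, (ψ p).2 + (ψ p).1 ^ 2 * w (ψ p).1)) 0 :=
    AnalyticAt.fun_comp_of_eq (f := ψ) hσ hψ hψ0
  have hφ0 : (fun p => ((ψ p).1, (ψ p).2 + (ψ p).1 ^ 2 * w (ψ p).1)) 0 = 0 := by
    simp [hψ0]
  have hfst : Tendsto (Prod.fst : ℂ × ℂ → ℂ) (𝓝 0) (𝓝 0) := continuous_fst.tendsto 0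
  have tσ : Tendsto (fun z : ℂ × ℂ => (z.1, z.2 + z.1 ^ 2 * w z.1)) (𝓝 0) (𝓝 0) := by
    simpa [ContinuousAt, Prod.mk_zero_zero] using hσ.continuousAt
  have tψ : Tendsto ψ (𝓝 0) (𝓝 0) := by
    simpa [ContinuousAt, hψ0] using hψ.continuousAt
  have tφ : Tendsto (fun p => ((ψ p).1, (ψ p).2 + (ψ p).1 ^ 2 * w (ψ p).1)) (𝓝 0) (𝓝 0) :=
    tσ.comp tψ
  have hform : ∀ᶠ z in 𝓝 (0 : ℂ × ℂ), ρ (z.1, z.2 + z.1 ^ 2 * w z.1)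
      = (Θ z).2 ^ 3 + (Θ z).1 ^ 3 * (Θ z).2 := by
    filter_upwards [hnorm, hH1e, hfst.eventually hwe, tσ.eventually hρe] with z n1 n2 n3 n4
    rw [← n1, n4]
    simp only [zero_add] at n2 n3 ⊢
    linear_combination z.1 ^ 5 * n3 + z.1 ^ 6 * w z.1 ^ 3 * n2
  obtain ⟨V, hV, hVo, hV0⟩ := eventually_nhds_iff.mp
    ((hφ.eventually_analyticAt.and hΘψ).and
      ((tφ.eventually (hU.mem_nhds h0U)).and (tψ.eventually hform)))
  refine ⟨V, fun p => ((ψ p).1, (ψ p).2 + (ψ p).1 ^ 2 * w (ψ p).1), hVo, hV0,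
    fun p hp => (hV p hp).1.1, hφ0, ?_, fun p hp => (hV p hp).2.1, ?_⟩
  · intro p hp q hq hpq
    simp only [Prod.mk.injEq] at hpq
    obtain ⟨h1, h2⟩ := hpq
    rw [h1] at h2
    have : ψ p = ψ q := Prod.ext h1 (add_right_cancel h2)
    rw [← (hV p hp).1.2, ← (hV q hq).1.2, this]
  · intro p hp
    have := (hV p hp).2.2
    rw [(hV p hp).1.2] at this
    exact this
end
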